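/- arXiv:2101.02329 — 4 statements merged into one kernel-verified Lean document; each statement's English description precedes it below -/
import Mathlib

section
/- Let P be a finite ranked poset, A an antichain of P, X = supp(A), and P_X = {q ∈ P : q ≱ p for all minimal p ∉ X}. Then (row^{-1} ∘ Rvac)(A) computed in P equals (row^{-1} ∘ Rvac)(A) computed in the subposet P_X. -/
open scoped Classical

variable {α : Type*}

noncomputable def toggle [PartialOrder α] (p : α) (A : Finset α) : Finset α :=
  if p ∈ A then A.erase p
  else if IsAntichain (· ≤ ·) (↑(insert p A) : Set α) then insert p A
  else A

noncomputable def rowmotion [Fintype α] [PartialOrder α] (A : Finset α) : Finset α :=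
  Finset.univ.filter
    (fun x => (∀ y ∈ A, ¬ x ≤ y) ∧ ∀ z : α, (∀ y ∈ A, ¬ z ≤ y) → z ≤ x → z = x)

noncomputable def rankToggle [Fintype α] [PartialOrder α] (rk : α → ℕ) (i : ℕ)
    (A : Finset α) : Finset α :=
  (Finset.univ.filter (fun p => rk p = i)).toList.foldr toggle A

noncomputable def rvac [Fintype α] [PartialOrder α] (rk : α → ℕ) (N : ℕ)
    (A : Finset α) : Finset α :=
  (List.range (N + 1)).foldl
    (fun B k => (List.range' k (N + 1 - k)).foldl (fun C j => rankToggle rk j C) B) A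

def IsRankFunction [PartialOrder α] (rk : α → ℕ) : Prop :=
  (∀ p : α, (∀ q : α, ¬ q < p) → rk p = 0) ∧ ∀ x y : α, x ⋖ y → rk y = rk x + 1

noncomputable def rankToggleOn [Fintype α] [PartialOrder α] (s : Set α)
    (rk : α → ℕ) (i : ℕ) (A : Finset α) : Finset α :=
  (Finset.univ.filter (fun p => p ∈ s ∧ rk p = i)).toList.foldr toggle A

noncomputable def rvacOn [Fintype α] [PartialOrder α] (s : Set α) (rk : α → ℕ)
    (N : ℕ) (A : Finset α) : Finset α :=
  (List.range (N + 1)).foldl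
    (fun B k => (List.range' k (N + 1 - k)).foldl
      (fun C j => rankToggleOn s rk j C) B) A

noncomputable def rowmotionOn [Fintype α] [PartialOrder α] (s : Set α)
    (A : Finset α) : Finset α :=
  Finset.univ.filter
    (fun x => x ∈ s ∧ (∀ y ∈ A, ¬ x ≤ y) ∧
      ∀ z ∈ s, (∀ y ∈ A, ¬ z ≤ y) → z ≤ x → z = x)

theorem aux_lt [Fintype α] [PartialOrder α] {rk : α → ℕ} (hrk : IsRankFunction rk) {x y : α}
    (h : x < y) : rk x < rk y := by
  let _ : LocallyFiniteOrder α := Fintype.toLocallyFiniteOrder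
  have h2 := transGen_covBy_of_lt h
  clear h
  induction h2 with
  | single h => have := hrk.2 _ _ h; omega
  | tail h1 h2 ih =>
    have := hrk.2 _ _ h2
    omega

theorem aux_rankToggleOn_empty [Fintype α] [PartialOrder α] (s : Set α) (rk : α → ℕ) (i : ℕ)
    (h : ∀ p ∈ s, rk p ≠ i) (A : Finset α) : rankToggleOn s rk i A = A := by
  unfold rankToggleOn
  rw [Finset.filter_eq_empty_iff.2 (fun p _ hp => h p hp.1 hp.2)]
  simp

theorem aux_mem_toggle [PartialOrder α] {A : Finset α} (hA : IsAntichain (· ≤ ·) (↑A : Set α))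
    (p x : α) : x ∈ toggle p A ↔
      (x ∈ A ∧ x ≠ p) ∨ (x = p ∧ x ∉ A ∧ ∀ a ∈ A, ¬ a ≤ x ∧ ¬ x ≤ a) := by
  unfold toggle
  split_ifs with h1 h2
  · rw [Finset.mem_erase]; grind
  · rw [Finset.coe_insert, isAntichain_insert] at h2
    rw [Finset.mem_insert]
    constructor
    · rintro (rfl | h)
      · refine Or.inr ⟨rfl, h1, fun a ha => ?_⟩
        have hne : x ≠ a := by rintro rfl; exact h1 ha
        exact ⟨(h2.2 ha hne).2, (h2.2 ha hne).1⟩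
      · left; refine ⟨h, ?_⟩; rintro rfl; exact h1 h
    · rintro (h | h)
      · exact Or.inr h.1
      · exact Or.inl h.1
  · constructor
    · intro h; left; refine ⟨h, ?_⟩; rintro rfl; exact h1 h
    · rintro (h | ⟨rfl, h, h'⟩)
      · exact h.1
      · exfalso; apply h2
        rw [Finset.coe_insert, isAntichain_insert]
        exact ⟨hA, fun a ha _ => ⟨(h' a ha).2, (h' a ha).1⟩⟩

theorem aux_toggle_antichain [PartialOrder α] {A : Finset α}
    (hA : IsAntichain (· ≤ ·) (↑A : Set α)) (p : α) :
    IsAntichain (· ≤ ·) (↑(toggle p A) : Set α) := by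
  unfold toggle
  split_ifs with h1 h2
  · exact hA.subset (by simp)
  · exact h2
  · exact hA

theorem aux_foldr_antichain [PartialOrder α] {A : Finset α}
    (hA : IsAntichain (· ≤ ·) (↑A : Set α)) (l : List α) :
    IsAntichain (· ≤ ·) (↑(l.foldr toggle A) : Set α) := by
  induction l with
  | nil => exact hA
  | cons p l ih => exact aux_toggle_antichain ih p

theorem aux_mem_foldr [PartialOrder α] {A : Finset α} (hA : IsAntichain (· ≤ ·) (↑A : Set α))
    (l : List α) (hl : l.Nodup) (hc : ∀ x ∈ l, ∀ y ∈ l, ¬ x < y) (x : α) :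
    x ∈ l.foldr toggle A ↔
      (x ∈ A ∧ x ∉ l) ∨ (x ∈ l ∧ x ∉ A ∧ ∀ a ∈ A, ¬ a ≤ x ∧ ¬ x ≤ a) := by
  induction l generalizing x with
  | nil => simp
  | cons p l ih =>
    have hpl : p ∉ l := (List.nodup_cons.1 hl).1
    have ih' := fun x => ih (List.nodup_cons.1 hl).2
      (fun x hx y hy => hc x (List.mem_cons_of_mem _ hx) y (List.mem_cons_of_mem _ hy)) x
    rw [List.foldr_cons, aux_mem_toggle (aux_foldr_antichain hA l), ih' x]
    by_cases hxp : x = p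
    · subst hxp
      have key : (∀ a ∈ l.foldr toggle A, ¬ a ≤ x ∧ ¬ x ≤ a) ∧ x ∉ A ↔
          x ∉ A ∧ ∀ a ∈ A, ¬ a ≤ x ∧ ¬ x ≤ a := by
        have inc : ∀ a ∈ l, ¬ a ≤ x ∧ ¬ x ≤ a := by
          intro a ha
          have hne : a ≠ x := by rintro rfl; exact hpl ha
          exact ⟨fun h => hc a (List.mem_cons_of_mem _ ha) x List.mem_cons_self
              (lt_of_le_of_ne h hne),
            fun h => hc x List.mem_cons_self a (List.mem_cons_of_mem _ ha)
              (lt_of_le_of_ne h hne.symm)⟩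
        constructor
        · rintro ⟨h, h'⟩
          refine ⟨h', fun a ha => ?_⟩
          by_cases hal : a ∈ l
          · exact inc a hal
          · exact h a ((ih' a).2 (Or.inl ⟨ha, hal⟩))
        · rintro ⟨h, h'⟩
          refine ⟨fun a ha => ?_, h⟩
          rcases (ih' a).1 ha with h3 | h3
          · exact h' a h3.1
          · exact inc a h3.1
      simp only [List.mem_cons, true_or, hpl]
      tauto
    · simp only [List.mem_cons, hxp, false_or]
      tauto

theorem aux_mem_rankToggleOn [Fintype α] [PartialOrder α] {rk : α → ℕ} (hrk : IsRankFunction rk)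
    {A : Finset α} (hA : IsAntichain (· ≤ ·) (↑A : Set α)) (s : Set α) (i : ℕ) (x : α) :
    x ∈ rankToggleOn s rk i A ↔
      (x ∈ A ∧ ¬ (x ∈ s ∧ rk x = i)) ∨
        ((x ∈ s ∧ rk x = i) ∧ x ∉ A ∧ ∀ a ∈ A, ¬ a ≤ x ∧ ¬ x ≤ a) := by
  unfold rankToggleOn
  rw [aux_mem_foldr hA _ (Finset.nodup_toList _)]
  · simp
  · intro x hx y hy h
    have := aux_lt hrk h
    simp at hx hy
    omega

theorem aux_rankToggle_eq [Fintype α] [PartialOrder α] (rk : α → ℕ) (i : ℕ) (A : Finset α) :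
    rankToggle rk i A = rankToggleOn Set.univ rk i A := by
  unfold rankToggle rankToggleOn
  simp

/-- the nested fold -/
def auxFold {β : Type*} (f : ℕ → β → β) (N : ℕ) (b : β) : β :=
  (List.range (N + 1)).foldl
    (fun B k => (List.range' k (N + 1 - k)).foldl (fun C j => f j C) B) b

theorem auxFold_succ {β : Type*} (f : ℕ → β → β) (N : ℕ) (h : ∀ b, f (N + 1) b = b) (b : β) :
    auxFold f (N + 1) b = auxFold f N b := by
  unfold auxFold
  rw [List.range_succ, List.foldl_append]
  have e : N + 1 + 1 - (N + 1) = 1 := by omega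
  simp only [List.foldl_cons, List.foldl_nil, e, List.range'_one, h]
  apply List.foldl_ext
  intro B k hk
  have hk' : k < N + 1 := List.mem_range.1 hk
  have e2 : N + 1 + 1 - k = (N + 1 - k) + 1 := by omega
  rw [e2, List.range'_concat, List.foldl_append]
  have e3 : k + 1 * (N + 1 - k) = N + 1 := by omega
  simp only [List.foldl_cons, List.foldl_nil, e3, h]

theorem auxFold_le {β : Type*} (f : ℕ → β → β) (N M : ℕ) (hNM : N ≤ M)
    (h : ∀ j, N < j → ∀ b, f j b = b) (b : β) :
    auxFold f M b = auxFold f N b := by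
  induction M, hNM using Nat.le_induction with
  | base => rfl
  | succ m hm ih => rw [auxFold_succ f m (h _ (by omega)), ih]

theorem aux_foldl_rel {β γ ι : Type*} (R : β → γ → Prop) (f : β → ι → β) (g : γ → ι → γ)
    (l : List ι) (h : ∀ i ∈ l, ∀ b c, R b c → R (f b i) (g c i)) (b : β) (c : γ) (hR : R b c) :
    R (l.foldl f b) (l.foldl g c) := by
  induction l generalizing b c with
  | nil => exact hR
  | cons i l ih =>
    exact ih (fun j hj => h j (List.mem_cons_of_mem _ hj)) _ _ (h i List.mem_cons_self _ _ hR)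

theorem auxFold_rel {β γ : Type*} (R : β → γ → Prop) (f : ℕ → β → β) (g : ℕ → γ → γ) (N : ℕ)
    (b : β) (c : γ) (h0 : R (f 0 b) (g 0 c))
    (h : ∀ i, 1 ≤ i → ∀ b c, R b c → R (f i b) (g i c)) :
    R (auxFold f N b) (auxFold g N c) := by
  unfold auxFold
  rw [List.range_succ_eq_map, List.foldl_cons, List.foldl_cons]
  apply aux_foldl_rel R
  · intro k hk b c hR
    apply aux_foldl_rel R _ _ _ _ _ _ hR
    intro j hj
    apply h
    obtain ⟨k', -, rfl⟩ := List.mem_map.1 hk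
    have := List.mem_range'_1.1 hj
    omega
  · rw [Nat.sub_zero, List.range'_succ, List.foldl_cons, List.foldl_cons]
    apply aux_foldl_rel R _ _ _ _ _ _ h0
    intro j hj
    apply h
    have := List.mem_range'_1.1 hj
    omega

theorem aux_exists_min [Fintype α] [PartialOrder α] (q : α) (p : α → Prop) (hq : p q) :
    ∃ z, z ≤ q ∧ p z ∧ ∀ w, p w → w ≤ z → w = z := by
  induction q using WellFoundedLT.induction with
  | ind q ih =>
    by_cases h : ∃ w, p w ∧ w < q
    · obtain ⟨w, hw, hlt⟩ := h
      obtain ⟨z, h1, h2, h3⟩ := ih w hlt hw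
      exact ⟨z, h1.trans hlt.le, h2, h3⟩
    · push Not at h
      exact ⟨q, le_rfl, hq, fun w hw hle => by_contra fun hne => h w hw (lt_of_le_of_ne hle hne)⟩

/-- the core relation -/
theorem aux_core [Fintype α] [PartialOrder α] {rk : α → ℕ} (hrk : IsRankFunction rk)
    (A : Finset α) (hA : IsAntichain (· ≤ ·) (↑A : Set α)) (Y s : Set α)
    (hY : ∀ p, p ∈ Y ↔ (∀ r, ¬ r < p) ∧ ∀ a ∈ A, ¬ p ≤ a)
    (hs : ∀ q, q ∈ s ↔ ∀ p ∈ Y, ¬ p ≤ q) (N : ℕ) :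
    ∀ x, x ∈ auxFold (rankToggleOn Set.univ rk) N A ↔
      (x ∈ Y ∨ x ∈ auxFold (rankToggleOn s rk) N A) := by
  have hAs : ∀ a ∈ A, a ∈ s := fun a ha => (hs a).2 fun p hp => ((hY p).1 hp).2 a ha
  have hmin0 : ∀ p, rk p = 0 → ∀ r, ¬ r < p := fun p hp r hr => by
    have := aux_lt hrk hr; omega
  have hYs : ∀ y ∈ Y, y ∉ s := fun y hy h => (hs y).1 h y hy le_rfl
  have hinc : ∀ y ∈ Y, ∀ t ∈ s, ¬ y ≤ t ∧ ¬ t ≤ y := by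
    intro y hy t ht
    refine ⟨(hs t).1 ht y hy, fun h => ?_⟩
    rcases eq_or_lt_of_le h with h | h
    · subst h; exact hYs _ hy ht
    · exact ((hY y).1 hy).1 t h
  have ant : ∀ S T : Finset α, IsAntichain (· ≤ ·) (↑T : Set α) → (∀ t ∈ T, t ∈ s) →
      (∀ x, x ∈ S ↔ (x ∈ Y ∨ x ∈ T)) → IsAntichain (· ≤ ·) (↑S : Set α) := by
    intro S T hT hTs hST a ha b hb hne hab
    rcases (hST a).1 ha with h1 | h1 <;> rcases (hST b).1 hb with h2 | h2
    · exact ((hY b).1 h2).1 a (lt_of_le_of_ne hab hne)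
    · exact (hinc a h1 b (hTs b h2)).1 hab
    · exact (hinc b h2 a (hTs a h1)).2 hab
    · exact hT h1 h2 hne hab
  have antR : ∀ (T : Finset α) i, IsAntichain (· ≤ ·) (↑T : Set α) →
      IsAntichain (· ≤ ·) (↑(rankToggleOn s rk i T) : Set α) := by
    intro T i hT
    exact aux_foldr_antichain hT _
  have main := auxFold_rel
    (fun S T : Finset α => IsAntichain (· ≤ ·) (↑T : Set α) ∧ (∀ t ∈ T, t ∈ s) ∧
      (∀ x, x ∈ S ↔ (x ∈ Y ∨ x ∈ T)))
    (rankToggleOn Set.univ rk) (rankToggleOn s rk) N A A ?_ ?_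
  · exact main.2.2
  · refine ⟨antR _ _ hA, ?_, ?_⟩
    · intro t ht
      rw [aux_mem_rankToggleOn hrk hA] at ht
      rcases ht with h | h
      · exact hAs t h.1
      · exact h.1.1
    · intro x
      rw [aux_mem_rankToggleOn hrk hA, aux_mem_rankToggleOn hrk hA]
      have h1 := hAs x
      have h2 : rk x = 0 → x ∉ Y → ¬ ∀ a ∈ A, ¬ a ≤ x ∧ ¬ x ≤ a := by
        intro h0 hy h
        exact hy ((hY x).2 ⟨hmin0 x h0, fun a ha => (h a ha).2⟩)
      have h3 : x ∈ Y → rk x = 0 ∧ ∀ a ∈ A, ¬ a ≤ x ∧ ¬ x ≤ a := fun hy =>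
        ⟨hrk.1 x ((hY x).1 hy).1, fun a ha => (hinc x hy a (hAs a ha)).symm⟩
      have h4 := hYs x
      simp only [Set.mem_univ, true_and]
      tauto
  · rintro i hi S T ⟨hT, hTs, hST⟩
    refine ⟨antR _ _ hT, ?_, ?_⟩
    · intro t ht
      rw [aux_mem_rankToggleOn hrk hT] at ht
      rcases ht with h | h
      · exact hTs t h.1
      · exact h.1.1
    · intro x
      rw [aux_mem_rankToggleOn hrk (ant S T hT hTs hST), aux_mem_rankToggleOn hrk hT, hST x]
      have h1 := hTs x
      have h2 : x ∈ Y → rk x = 0 := fun hy => hrk.1 x ((hY x).1 hy).1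
      have h3 : (∀ a ∈ S, ¬ a ≤ x ∧ ¬ x ≤ a) ↔ (x ∈ s ∧ ∀ a ∈ T, ¬ a ≤ x ∧ ¬ x ≤ a) := by
        constructor
        · intro h
          exact ⟨(hs x).2 fun p hp => (h p ((hST p).2 (Or.inl hp))).1,
            fun a ha => h a ((hST a).2 (Or.inr ha))⟩
        · rintro ⟨h, h'⟩ a ha
          rcases (hST a).1 ha with h5 | h5
          · exact hinc a h5 x h
          · exact h' a h5
      have h4 := hYs x
      have h5 : rk x = i → x ∉ Y := fun h h' => by have := h2 h'; omega
      rw [h3]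
      simp only [Set.mem_univ, true_and]
      tauto

theorem aux_final [Fintype α] [PartialOrder α] (Y s : Set α) (B B' : Finset α)
    (hs : ∀ q, q ∈ s ↔ ∀ p ∈ Y, ¬ p ≤ q)
    (hB : IsAntichain (· ≤ ·) (↑B : Set α)) (hB' : IsAntichain (· ≤ ·) (↑B' : Set α))
    (hB's : (↑B' : Set α) ⊆ s)
    (h : ∀ x, x ∈ rowmotion B ↔ (x ∈ Y ∨ x ∈ rowmotionOn s B')) : B = B' := by
  have hdown : ∀ x y, x ≤ y → y ∈ s → x ∈ s := fun x y hxy hy =>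
    (hs x).2 fun p hp hpx => (hs y).1 hy p hp (hpx.trans hxy)
  -- the two order ideals agree
  have key : ∀ x, (∃ y ∈ B, x ≤ y) ↔ (∃ y ∈ B', x ≤ y) := by
    intro x
    constructor
    · rintro ⟨y, hy, hxy⟩
      by_contra hcon
      push Not at hcon
      have hex : ∃ w, w ≤ x ∧ w ∈ rowmotion B := by
        by_cases hx : x ∈ s
        · obtain ⟨z, h1, h2, h3⟩ := aux_exists_min x (fun z => z ∈ s ∧ ∀ y ∈ B', ¬ z ≤ y)
            ⟨hx, hcon⟩
          refine ⟨z, h1, (h z).2 (Or.inr ?_)⟩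
          simp only [rowmotionOn, Finset.mem_filter, Finset.mem_univ, true_and]
          exact ⟨h2.1, h2.2, fun w hw hw' hle => h3 w ⟨hw, hw'⟩ hle⟩
        · rw [hs] at hx
          push Not at hx
          obtain ⟨p, hp, hpx⟩ := hx
          exact ⟨p, hpx, (h p).2 (Or.inl hp)⟩
      obtain ⟨w, hwx, hw⟩ := hex
      simp only [rowmotion, Finset.mem_filter, Finset.mem_univ, true_and] at hw
      exact hw.1 y hy (hwx.trans hxy)
    · rintro ⟨y, hy, hxy⟩
      by_contra hcon
      push Not at hcon
      obtain ⟨z, h1, h2, h3⟩ := aux_exists_min x (fun z => ∀ y ∈ B, ¬ z ≤ y) hcon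
      have hz : z ∈ rowmotion B := by
        simp only [rowmotion, Finset.mem_filter, Finset.mem_univ, true_and]
        exact ⟨h2, h3⟩
      rcases (h z).1 hz with hzY | hzC
      · exact (hs y).1 (hB's hy) z hzY (h1.trans hxy)
      · simp only [rowmotionOn, Finset.mem_filter, Finset.mem_univ, true_and] at hzC
        exact hzC.2.1 y hy (h1.trans hxy)
  have sub : ∀ C D : Finset α, IsAntichain (· ≤ ·) (↑C : Set α) →
      (∀ x, (∃ y ∈ C, x ≤ y) ↔ (∃ y ∈ D, x ≤ y)) → C ⊆ D := by
    intro C D hC hk x hx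
    obtain ⟨y, hy, hxy⟩ := (hk x).1 ⟨x, hx, le_rfl⟩
    obtain ⟨z, hz, hyz⟩ := (hk y).2 ⟨y, hy, le_rfl⟩
    have : x = z := hC.eq hx hz (hxy.trans hyz)
    subst this
    rwa [le_antisymm hxy hyz]
  exact Finset.Subset.antisymm (sub B B' hB key) (sub B' B hB' fun x => (key x).symm)

/-- `(row⁻¹ ∘ Rvac)(A)` computed in `P` equals `(row⁻¹ ∘ Rvac)(A)` computed in
the parabolic subposet `P_X`, where `X = supp(A)`.  Here `B` (resp. `B'`) is the
unique antichain of `P` (resp. of `P_X`) whose rowmotion is `Rvac(A)` computed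
in `P` (resp. in `P_X`). -/
theorem rvac_row_inv_parabolic [Fintype α] [PartialOrder α] (rk : α → ℕ)
    (hrk : IsRankFunction rk) (A B B' : Finset α)
    (hA : IsAntichain (· ≤ ·) (↑A : Set α))
    (hB : IsAntichain (· ≤ ·) (↑B : Set α))
    (hrowB : rowmotion B = rvac rk (Finset.univ.sup rk) A)
    (hB' : IsAntichain (· ≤ ·) (↑B' : Set α))
    (hB's : (↑B' : Set α) ⊆
      {q : α | ∀ p : α, (∀ r : α, ¬ r < p) →
        p ∉ {p : α | (∀ r : α, ¬ r < p) ∧ ∃ a ∈ A, p ≤ a} → ¬ p ≤ q})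
    (hrowB' :
      rowmotionOn
        {q : α | ∀ p : α, (∀ r : α, ¬ r < p) →
          p ∉ {p : α | (∀ r : α, ¬ r < p) ∧ ∃ a ∈ A, p ≤ a} → ¬ p ≤ q} B' =
      rvacOn
        {q : α | ∀ p : α, (∀ r : α, ¬ r < p) →
          p ∉ {p : α | (∀ r : α, ¬ r < p) ∧ ∃ a ∈ A, p ≤ a} → ¬ p ≤ q} rk
        ((Finset.univ.filter (fun q : α => ∀ p : α, (∀ r : α, ¬ r < p) →
          p ∉ {p : α | (∀ r : α, ¬ r < p) ∧ ∃ a ∈ A, p ≤ a} → ¬ p ≤ q)).sup rk)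
        A) :
    B = B' := by
  set s : Set α := {q : α | ∀ p : α, (∀ r : α, ¬ r < p) →
          p ∉ {p : α | (∀ r : α, ¬ r < p) ∧ ∃ a ∈ A, p ≤ a} → ¬ p ≤ q} with hsdef
  let Y : Set α := {p | (∀ r, ¬ r < p) ∧ ∀ a ∈ A, ¬ p ≤ a}
  have hY : ∀ p, p ∈ Y ↔ (∀ r, ¬ r < p) ∧ ∀ a ∈ A, ¬ p ≤ a := fun p => Iff.rfl
  have hs : ∀ q, q ∈ s ↔ ∀ p ∈ Y, ¬ p ≤ q := by
    intro q
    constructor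
    · intro h p hp
      exact h p hp.1 (fun hp' => by obtain ⟨-, a, ha, hpa⟩ := hp'; exact hp.2 a ha hpa)
    · intro h p hp hp'
      exact h p ⟨hp, fun a ha hpa => hp' ⟨hp, a, ha, hpa⟩⟩
  apply aux_final Y s B B' hs hB hB' hB's
  intro x
  have e1 : rvac rk (Finset.univ.sup rk) A =
      auxFold (rankToggleOn Set.univ rk) (Finset.univ.sup rk) A := by
    unfold rvac auxFold
    simp only [aux_rankToggle_eq]
  rw [hrowB, hrowB', e1, aux_core hrk A hA Y s hY hs]
  apply or_congr Iff.rfl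
  rw [auxFold_le _ _ _ (Finset.sup_mono (Finset.filter_subset
    (fun q : α => ∀ p : α, (∀ r : α, ¬ r < p) →
          p ∉ {p : α | (∀ r : α, ¬ r < p) ∧ ∃ a ∈ A, p ≤ a} → ¬ p ≤ q) Finset.univ))]
  · rfl
  · intro j hj b
    apply aux_rankToggleOn_empty
    rintro p hp rfl
    refine absurd hj (not_lt.2 (Finset.le_sup (f := rk) ?_))
    exact Finset.mem_filter.2 ⟨Finset.mem_univ _, hp⟩
end

section
/- Let A be an antichain of the type A_{n-1} root poset, written as A = {[i_1,j_1], …, [i_k,j_k]} with i_1 < ⋯ < i_k and j_1 < ⋯ < j_k. Define {i'_1 < ⋯ < i'_{n-1-k}} = {1,…,n−1} \ {j_1−1,…,j_k−1} and {j'_1 < ⋯ < j'_{n-1-k}} = {2,…,n} \ {i_1+1,…,i_k+1}. Then Rvac(A) = {[i'_1,j'_1], …, [i'_{n-1-k}, j'_{n-1-k}]}. -/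
open scoped Classical

variable {α : Type*}

/-- The type `A_{n-1}` root poset: intervals `[i,j]` with `1 ≤ i < j ≤ n`,
ordered by containment. -/
def RootPoset (n : ℕ) : Type :=
  {p : Fin (n + 1) × Fin (n + 1) // 1 ≤ p.1.1 ∧ p.1.1 < p.2.1}

instance (n : ℕ) : Fintype (RootPoset n) := by unfold RootPoset; infer_instance
instance (n : ℕ) : DecidableEq (RootPoset n) := by unfold RootPoset; infer_instance

/-- Left endpoint of the interval. -/
def RootPoset.fst {n : ℕ} (a : RootPoset n) : ℕ := a.1.1.1
/-- Right endpoint of the interval. -/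
def RootPoset.snd {n : ℕ} (a : RootPoset n) : ℕ := a.1.2.1

instance (n : ℕ) : PartialOrder (RootPoset n) where
  le a b := b.fst ≤ a.fst ∧ a.snd ≤ b.snd
  le_refl a := ⟨le_rfl, le_rfl⟩
  le_trans a b c h1 h2 := ⟨le_trans h2.1 h1.1, le_trans h1.2 h2.2⟩
  le_antisymm a b h1 h2 := by
    obtain ⟨⟨a1, a2⟩, ha⟩ := a
    obtain ⟨⟨b1, b2⟩, hb⟩ := b
    simp only [RootPoset.fst, RootPoset.snd] at h1 h2
    have e1 : a1 = b1 := Fin.ext (le_antisymm h2.1 h1.1)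
    have e2 : a2 = b2 := Fin.ext (le_antisymm h1.2 h2.2)
    subst e1; subst e2; rfl

/-- The rank function of the root poset: `rk [i,j] = j - i - 1`. -/
def RootPoset.rk {n : ℕ} (a : RootPoset n) : ℕ := a.snd - a.fst - 1


section General
variable {β : Type*} [PartialOrder β]

/-- `x` is incomparable to every element of `A`. -/
def IncTo (x : β) (A : Finset β) : Prop := ∀ a ∈ A, ¬ a ≤ x ∧ ¬ x ≤ a

lemma toggle_spec (p : β) (A : Finset β) (hA : IsAntichain (· ≤ ·) (↑A : Set β)) :
    IsAntichain (· ≤ ·) (↑(toggle p A) : Set β) ∧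
    ∀ x, x ∈ toggle p A ↔ (x ≠ p ∧ x ∈ A) ∨ (x = p ∧ IncTo x A) := by
  unfold toggle
  split_ifs with h1 h2
  · refine ⟨hA.subset (by simp), fun x => ?_⟩
    rw [Finset.mem_erase]
    constructor
    · intro h; exact Or.inl h
    · rintro (h | ⟨rfl, h⟩)
      · exact h
      · exact absurd le_rfl (h x h1).1
  · refine ⟨h2, fun x => ?_⟩
    rw [Finset.mem_insert]
    constructor
    · rintro (rfl | h)
      · right
        refine ⟨rfl, fun a ha => ?_⟩
        have hne : a ≠ x := fun h => h1 (h ▸ ha)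
        exact ⟨h2 (by simp [ha]) (by simp) hne, h2 (by simp) (by simp [ha]) hne.symm⟩
      · left; exact ⟨fun hh => h1 (hh ▸ h), h⟩
    · rintro (h | h)
      · exact Or.inr h.2
      · exact Or.inl h.1
  · refine ⟨hA, fun x => ?_⟩
    constructor
    · intro h; left; exact ⟨fun hh => h1 (hh ▸ h), h⟩
    · rintro (h | ⟨rfl, h⟩)
      · exact h.2
      · exfalso
        apply h2
        rw [Finset.coe_insert]
        refine hA.insert ?_ ?_
        · intro b hb _; exact (h b hb).1
        · intro b hb _; exact (h b hb).2

lemma foldr_spec (rk : β → ℕ) (hrk : StrictMono rk) (i : ℕ) (A : Finset β)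
    (hA : IsAntichain (· ≤ ·) (↑A : Set β)) (l : List β) (hl : l.Nodup)
    (hi : ∀ x ∈ l, rk x = i) :
    IsAntichain (· ≤ ·) (↑(l.foldr toggle A) : Set β) ∧
    ∀ x, x ∈ l.foldr toggle A ↔ (x ∉ l ∧ x ∈ A) ∨ (x ∈ l ∧ IncTo x A) := by
  induction l with
  | nil => exact ⟨hA, by simp⟩
  | cons p l ih =>
    rw [List.nodup_cons] at hl
    obtain ⟨ih1, ih2⟩ := ih hl.2 (fun x hx => hi x (by simp [hx]))
    obtain ⟨t1, t2⟩ := toggle_spec p _ ih1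
    rw [List.foldr_cons]
    refine ⟨t1, fun x => ?_⟩
    rw [t2]
    have key : x = p → (IncTo x (l.foldr toggle A) ↔ IncTo x A) := by
      rintro rfl
      have same : ∀ y, rk y = i → y ≠ x → ¬ y ≤ x ∧ ¬ x ≤ y := by
        intro y hy hne
        have hx := hi x (by simp)
        constructor
        · intro h; have := hrk (lt_of_le_of_ne h hne); omega
        · intro h; have := hrk (lt_of_le_of_ne h hne.symm); omega
      constructor
      · intro h a ha
        by_cases hal : a ∈ l
        · exact same a (hi a (by simp [hal])) (fun h => hl.1 (h ▸ hal))
        · exact h a ((ih2 a).2 (Or.inl ⟨hal, ha⟩))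
      · intro h a ha
        rcases (ih2 a).1 ha with h' | h'
        · exact h a h'.2
        · exact same a (hi a (by simp [h'.1])) (fun h => hl.1 (h ▸ h'.1))
    rw [ih2, List.mem_cons]
    by_cases hx : x = p
    · have := key hx
      subst hx
      simp [this]
    · simp [hx]

lemma rankToggle_spec [Fintype β] (rk : β → ℕ) (hrk : StrictMono rk) (i : ℕ) (A : Finset β)
    (hA : IsAntichain (· ≤ ·) (↑A : Set β)) :
    IsAntichain (· ≤ ·) (↑(rankToggle rk i A) : Set β) ∧
    ∀ x, x ∈ rankToggle rk i A ↔ (rk x ≠ i ∧ x ∈ A) ∨ (rk x = i ∧ IncTo x A) := by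
  have := foldr_spec rk hrk i A hA (Finset.univ.filter (fun p => rk p = i)).toList
    (Finset.nodup_toList _) (by simp)
  refine ⟨this.1, fun x => ?_⟩
  have := this.2 x
  simpa [rankToggle] using this

/-- Elements available for the sweep starting at rank `k` and not below the current antichain. -/
def GoodAt (rk : β → ℕ) (k : ℕ) (B : Finset β) (x : β) : Prop :=
  k ≤ rk x ∧ (∀ f ∈ B, rk f < k → ¬ f ≤ x) ∧ (∀ b ∈ B, k ≤ rk b → ¬ x ≤ b)

/-- Minimal good elements. -/
def MinGood (rk : β → ℕ) (k : ℕ) (B : Finset β) (x : β) : Prop :=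
  GoodAt rk k B x ∧ ∀ y, GoodAt rk k B y → y ≤ x → y = x

lemma exists_minGood [Fintype β] (rk : β → ℕ) (k : ℕ) (B : Finset β) (x : β)
    (hx : GoodAt rk k B x) : ∃ y ≤ x, MinGood rk k B y := by
  obtain ⟨y, hyx, hy⟩ := (Set.toFinite {z | GoodAt rk k B z}).exists_le_minimal hx
  exact ⟨y, hyx, hy.prop, fun z hz hzy => le_antisymm hzy (hy.le_of_le hz hzy)⟩

lemma sweep_spec [Fintype β] (rk : β → ℕ) (hrk : StrictMono rk) (k m : ℕ) (B : Finset β)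
    (hB : IsAntichain (· ≤ ·) (↑B : Set β)) :
    IsAntichain (· ≤ ·)
      (↑((List.range' k m).foldl (fun C j => rankToggle rk j C) B) : Set β) ∧
    ∀ x, x ∈ (List.range' k m).foldl (fun C j => rankToggle rk j C) B ↔
      (rk x < k ∧ x ∈ B) ∨ (k ≤ rk x ∧ rk x < k + m ∧ MinGood rk k B x) ∨
      (k + m ≤ rk x ∧ x ∈ B) := by
  induction m with
  | zero =>
    refine ⟨hB, fun x => ?_⟩
    simp only [List.range'_zero, List.foldl_nil]
    by_cases h : rk x < k
    · simp [h]; try omega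
    · simp [h]; try omega
  | succ m ih =>
    obtain ⟨ih1, ih2⟩ := ih
    rw [List.range'_1_concat, List.foldl_append, List.foldl_cons, List.foldl_nil]
    obtain ⟨t1, t2⟩ := rankToggle_spec rk hrk (k + m) _ ih1
    refine ⟨t1, fun x => ?_⟩
    rw [t2, ih2]
    have rkle : ∀ a b : β, a ≤ b → rk a ≤ rk b := fun a b h => hrk.monotone h
    by_cases hx : rk x = k + m
    · have e1 : IncTo x ((List.range' k m).foldl (fun C j => rankToggle rk j C) B) ↔
          MinGood rk k B x := by
        constructor
        · intro h
          have hg : GoodAt rk k B x := by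
            refine ⟨by omega, ?_, ?_⟩
            · intro f hf hfk
              exact (h f ((ih2 f).2 (Or.inl ⟨hfk, hf⟩))).1
            · intro b hb hbk hxb
              have := rkle _ _ hxb
              exact (h b ((ih2 b).2 (Or.inr (Or.inr ⟨by omega, hb⟩)))).2 hxb
          refine ⟨hg, fun y hy hyx => ?_⟩
          by_contra hne
          obtain ⟨z, hzy, hz⟩ := exists_minGood rk k B y hy
          have h1 := hrk (lt_of_le_of_ne hyx hne)
          have h2 := rkle _ _ hzy
          have h3 := hz.1.1
          exact (h z ((ih2 z).2 (Or.inr (Or.inl ⟨h3, by omega, hz⟩)))).1 (hzy.trans hyx)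
        · intro h a ha
          rcases (ih2 a).1 ha with ⟨h1, h2⟩ | ⟨h1, h2, h3⟩ | ⟨h1, h2⟩
          · exact ⟨h.1.2.1 a h2 h1, fun hh => by have := rkle _ _ hh; omega⟩
          · refine ⟨fun hh => ?_, fun hh => by have := rkle _ _ hh; omega⟩
            have := h.2 a h3.1 hh
            subst this; omega
          · have hn := h.1.2.2 a h2 (by omega)
            refine ⟨fun hh => ?_, hn⟩
            rcases eq_or_lt_of_le hh with h' | h'
            · exact hn h'.ge
            · have := hrk h'; omega
      rw [e1]
      constructor
      · rintro (h | h)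
        · exact absurd hx h.1
        · exact Or.inr (Or.inl ⟨by omega, by omega, h.2⟩)
      · rintro (h | h | h)
        · omega
        · exact Or.inr ⟨hx, h.2.2⟩
        · omega
    · constructor
      · rintro (⟨_, h | h | h⟩ | h)
        · exact Or.inl h
        · exact Or.inr (Or.inl ⟨h.1, by omega, h.2.2⟩)
        · exact Or.inr (Or.inr ⟨by omega, h.2⟩)
        · exact absurd h.1 hx
      · rintro (h | h | h)
        · exact Or.inl ⟨hx, Or.inl h⟩
        · exact Or.inl ⟨hx, Or.inr (Or.inl ⟨h.1, by omega, h.2.2⟩)⟩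
        · exact Or.inl ⟨hx, Or.inr (Or.inr ⟨by omega, h.2⟩)⟩

end General

/-- Pairs version of `GoodAt`. -/
def GoodP (n k : ℕ) (B : ℕ → ℕ → Prop) (i j : ℕ) : Prop :=
  1 ≤ i ∧ j ≤ n ∧ i + k + 1 ≤ j ∧
  (∀ a b, B a b → b ≤ a + k → ¬ (i ≤ a ∧ b ≤ j)) ∧
  (∀ a b, B a b → a + k + 1 ≤ b → ¬ (a ≤ i ∧ j ≤ b))

/-- One sweep, as a relation between predicates on pairs. -/
def StepP (n k : ℕ) (B B' : ℕ → ℕ → Prop) : Prop :=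
  ∀ i j, B' i j ↔ (j ≤ i + k ∧ B i j) ∨
    (GoodP n k B i j ∧ ∀ a b, GoodP n k B a b → i ≤ a → b ≤ j → a = i ∧ b = j)

/-- Validity and antichain property. -/
def ValidP (n : ℕ) (B : ℕ → ℕ → Prop) : Prop :=
  (∀ i j, B i j → 1 ≤ i ∧ i < j ∧ j ≤ n) ∧
  ∀ i j a b, B i j → B a b → a ≤ i → j ≤ b → a = i ∧ b = j

/-- Left statistic. -/
def LStat (m : ℕ) (B : ℕ → ℕ → Prop) (p : ℕ) : Prop :=
  (∀ a, B a (p + 1) → a + m < p + 1) ∧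
  (p ≤ m ∨ (∃ a b, B a b ∧ b ≤ a + m ∧ p ≤ a + m ∧ b ≤ p + 1) ∨
    ∃ a b, B a b ∧ a + m < b ∧ a + m = p)

/-- Right statistic. -/
def RStat (n m : ℕ) (B : ℕ → ℕ → Prop) (p : ℕ) : Prop :=
  (∀ b, B p b → p + m < b) ∧
  (n < p + 1 + m ∨ (∃ a b, B a b ∧ b ≤ a + m ∧ p ≤ a ∧ b ≤ p + 1 + m) ∨
    ∃ a b, B a b ∧ a + m < b ∧ b = p + 1 + m)

lemma lstat_step (n m : ℕ) (B B' : ℕ → ℕ → Prop) (hB : ValidP n B) (h : StepP n m B B')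
    (p : ℕ) (hp : 1 ≤ p) (hpn : p + 1 ≤ n) : LStat m B p ↔ LStat (m + 1) B' p := by
  obtain ⟨hv, hanti⟩ := hB
  have low : ∀ i j, j ≤ i + m → (B' i j ↔ B i j) := by
    intro i j hij
    rw [h]
    constructor
    · rintro (h | h)
      · exact h.2
      · have := h.1.2.2.1; omega
    · intro h; exact Or.inl ⟨hij, h⟩
  have high : ∀ i j, i + m < j → (B' i j ↔ (GoodP n m B i j ∧ ∀ a b, GoodP n m B a b → i ≤ a → b ≤ j → a = i ∧ b = j)) := by
    intro i j hij
    rw [h]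
    constructor
    · rintro (h | h)
      · omega
      · exact h
    · intro h; exact Or.inr h
  by_cases hF : ∃ a, B a (p + 1) ∧ p + 1 ≤ a + m
  · obtain ⟨a, ha, ham⟩ := hF
    constructor
    · intro hh; have := hh.1 a ha; omega
    · intro hh; have := hh.1 a ((low _ _ ham).2 ha); omega
  push Not at hF
  by_cases hpm : p ≤ m
  · constructor
    · intro _
      refine ⟨?_, Or.inl (by omega)⟩
      intro a ha
      by_contra hlt
      rcases (h _ _).1 ha with h1 | h1
      · have := hF a h1.2; omega
      · have := h1.1.1; have := h1.1.2.2.1; omega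
    · intro _
      exact ⟨hF, Or.inl hpm⟩
  obtain ⟨q, rfl⟩ : ∃ q, p = q + m := ⟨p - m, by omega⟩
  have hq : 1 ≤ q := by omega
  by_cases hP : ∃ a b, B a b ∧ b ≤ a + m ∧ q ≤ a ∧ b ≤ q + m + 1
  · obtain ⟨a, b, h1, h2, h3, h4⟩ := hP
    constructor
    · intro _
      refine ⟨?_, Or.inr (Or.inl ⟨a, b, (low _ _ h2).2 h1, by omega, by omega, h4⟩)⟩
      intro c hc
      by_contra hlt
      rcases (h _ _).1 hc with h5 | h5
      · have := hF c h5.2; omega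
      · have h6 := h5.1.2.2.1
        exact h5.1.2.2.2.1 a b h1 h2 ⟨by omega, h4⟩
    · intro _
      exact ⟨hF, Or.inr (Or.inl ⟨a, b, h1, h2, by omega, h4⟩)⟩
  push Not at hP
  by_cases hL : ∃ t, B q t ∧ q + m < t
  · obtain ⟨t, ht, hqt⟩ := hL
    have hvt := hv _ _ ht
    have hl : LStat m B (q + m) := ⟨hF, Or.inr (Or.inr ⟨q, t, ht, hqt, rfl⟩)⟩
    refine iff_of_true hl ⟨?_, ?_⟩
    · intro c hc
      by_contra hlt
      rcases (h _ _).1 hc with h5 | h5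
      · have := hF c h5.2; omega
      · have h6 := h5.1.2.2.1
        exact h5.1.2.2.2.2 q t ht (by omega) ⟨by omega, by omega⟩
    · by_contra hcon
      push Not at hcon
      obtain ⟨c1, c2, c3⟩ := hcon
      -- [q-1,t] is good
      have hg : GoodP n m B (q - 1) t := by
        refine ⟨by omega, by omega, by omega, ?_, ?_⟩
        · rintro a b hab hbm ⟨h1, h2⟩
          rcases Nat.lt_or_ge a q with h3 | h3
          · have := c2 a b ((low _ _ hbm).2 hab) (by omega) (by omega)
            omega
          · have := hanti a b q t hab ht h3 h2
            omega
        · rintro a b hab hbm ⟨h1, h2⟩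
          have := hanti q t a b ht hab (by omega) h2
          omega
      have hex : ∃ s, GoodP n m B (q - 1) s := ⟨t, hg⟩
      classical
      have hs := Nat.find_spec hex
      have hmin := fun s' (h : s' < Nat.find hex) => Nat.find_min hex h
      have hst : Nat.find hex ≤ t := Nat.find_min' hex hg
      generalize Nat.find hex = s at hs hmin hst
      have hs3 := hs.2.2.1
      have hE : B' (q - 1) s := by
        rw [high _ _ (by omega)]
        refine ⟨hs, ?_⟩
        intro a b hab h1 h2
        have hab3 := hab.2.2.1
        rcases Nat.lt_or_ge a q with h3 | h3
        · have : a = q - 1 := by omega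
          subst this
          rcases Nat.lt_or_ge b s with h4 | h4
          · exact absurd hab (hmin b h4)
          · omega
        · exact absurd ⟨h3, by omega⟩ (hab.2.2.2.2 q t ht (by omega))
      rcases Nat.lt_or_ge (q - 1 + (m + 1)) s with h5 | h5
      · exact c3 _ _ hE h5 (by omega)
      · have := c2 _ _ hE h5 (by omega)
        omega
  · push Not at hL
    have hl : ¬ LStat m B (q + m) := by
      rintro ⟨_, h1 | ⟨a, b, h1, h2, h3, h4⟩ | ⟨a, b, h1, h2, h3⟩⟩
      · omega
      · have := hP a b h1 h2 (by omega); omega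
      · have : a = q := by omega
        subst this
        have := hL _ h1; omega
    refine iff_of_false hl ?_
    rintro ⟨h1, h2⟩
    -- some d above x
    have hd : ∃ y z, B y z ∧ y + m + 1 ≤ z ∧ y < q ∧ q + m + 1 ≤ z := by
      by_contra hcon
      push Not at hcon
      have hE : B' q (q + m + 1) := by
        rw [high _ _ (by omega)]
        refine ⟨⟨hq, hpn, by omega, ?_, ?_⟩, ?_⟩
        · rintro a b hab hbm ⟨h3, h4⟩
          have := hP a b hab hbm h3; omega
        · rintro a b hab hbm ⟨h3, h4⟩
          rcases Nat.lt_or_ge a q with h5 | h5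
          · have := hcon a b hab hbm h5; omega
          · have : a = q := by omega
            subst this
            have := hL _ hab; omega
        · intro a b hab h3 h4
          have := hab.2.2.1
          omega
      have := h1 q hE
      omega
    obtain ⟨y, z, hyz, hyz1, hyq, hz⟩ := hd
    have hvy := hv _ _ hyz
    rcases h2 with h2 | ⟨a, b, hab, h3, h4, h5⟩ | ⟨a, b, hab, h3, h4⟩
    · omega
    · rcases (h _ _).1 hab with h6 | h6
      · have := hanti a b y z h6.2 hyz (by omega) (by omega)
        omega
      · exact h6.1.2.2.2.2 y z hyz hyz1 ⟨by omega, by omega⟩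
    · have h6 := (high _ _ (by omega)).1 hab
      have hng : ¬ GoodP n m B (a + 1) b := by
        intro hg
        have := h6.2 _ _ hg (by omega) le_rfl
        omega
      apply hng
      obtain ⟨⟨g1, g2, g3, g4, g5⟩, g6⟩ := h6
      refine ⟨by omega, g2, by omega, ?_, ?_⟩
      · rintro c d hcd hdm ⟨h7, h8⟩
        exact g4 c d hcd hdm ⟨by omega, h8⟩
      · rintro c d hcd hdm ⟨h7, h8⟩
        rcases Nat.lt_or_ge c (a + 1) with h9 | h9
        · exact g5 c d hcd hdm ⟨by omega, h8⟩
        · have : c = q := by omega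
          subst this
          have := hL _ hcd; omega

/-- Reflection of a predicate on pairs. -/
def reflP (n : ℕ) (B : ℕ → ℕ → Prop) (i j : ℕ) : Prop :=
  1 ≤ i ∧ i ≤ n ∧ 1 ≤ j ∧ j ≤ n ∧ B (n + 1 - j) (n + 1 - i)

lemma refl_iff (n : ℕ) (B : ℕ → ℕ → Prop) (i j : ℕ) (hi : 1 ≤ i) (hj : 1 ≤ j)
    (hi' : i ≤ n) (hj' : j ≤ n) :
    reflP n B (n + 1 - j) (n + 1 - i) ↔ B i j := by
  have e1 : n + 1 - (n + 1 - i) = i := by omega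
  have e2 : n + 1 - (n + 1 - j) = j := by omega
  unfold reflP
  rw [e1, e2]
  constructor
  · intro h; exact h.2.2.2.2
  · intro h; exact ⟨by omega, by omega, by omega, by omega, h⟩

lemma validP_refl (n : ℕ) (B : ℕ → ℕ → Prop) (hB : ValidP n B) : ValidP n (reflP n B) := by
  constructor
  · rintro i j ⟨h1, h2, h3, h4, h5⟩
    have := hB.1 _ _ h5
    omega
  · rintro i j a b ⟨h1, h2, h3, h4, h5⟩ ⟨g1, g2, g3, g4, g5⟩ h6 h7
    have := hB.2 _ _ _ _ h5 g5 (by omega) (by omega)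
    omega

lemma goodP_refl (n k : ℕ) (B : ℕ → ℕ → Prop) (hB : ValidP n B) (i j : ℕ)
    (hi : 1 ≤ i) (hj' : j ≤ n) (hij : i < j) :
    GoodP n k (reflP n B) i j ↔ GoodP n k B (n + 1 - j) (n + 1 - i) := by
  constructor
  · rintro ⟨h1, h2, h3, h4, h5⟩
    refine ⟨by omega, by omega, by omega, ?_, ?_⟩
    · rintro a b hab hk ⟨h6, h7⟩
      have hv := hB.1 _ _ hab
      exact h4 (n + 1 - b) (n + 1 - a)
        ((refl_iff n B a b (by omega) (by omega) (by omega) (by omega)).2 hab)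
        (by omega) ⟨by omega, by omega⟩
    · rintro a b hab hk ⟨h6, h7⟩
      have hv := hB.1 _ _ hab
      exact h5 (n + 1 - b) (n + 1 - a)
        ((refl_iff n B a b (by omega) (by omega) (by omega) (by omega)).2 hab)
        (by omega) ⟨by omega, by omega⟩
  · rintro ⟨h1, h2, h3, h4, h5⟩
    refine ⟨by omega, by omega, by omega, ?_, ?_⟩
    · rintro a b ⟨g1, g2, g3, g4, hab⟩ hk ⟨h6, h7⟩
      exact h4 _ _ hab (by omega) ⟨by omega, by omega⟩
    · rintro a b ⟨g1, g2, g3, g4, hab⟩ hk ⟨h6, h7⟩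
      exact h5 _ _ hab (by omega) ⟨by omega, by omega⟩

lemma stepP_refl (n k : ℕ) (B B' : ℕ → ℕ → Prop) (hB : ValidP n B) (h : StepP n k B B') :
    StepP n k (reflP n B) (reflP n B') := by
  intro i j
  constructor
  · rintro ⟨h1, h2, h3, h4, h5⟩
    rcases (h _ _).1 h5 with ⟨h6, h7⟩ | ⟨h6, h7⟩
    · left
      exact ⟨by omega, h1, h2, h3, h4, h7⟩
    · right
      have := h6.2.2.1
      refine ⟨(goodP_refl n k B hB i j h1 h4 (by omega)).2 h6, ?_⟩
      intro a b hab h8 h9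
      have h10 := hab.2.2.1
      have := h7 _ _ ((goodP_refl n k B hB a b (by omega) (by omega) (by omega)).1 hab)
        (by omega) (by omega)
      omega
  · rintro (⟨h1, h2, h3, h4, h5, h6⟩ | ⟨h6, h7⟩)
    · refine ⟨h2, h3, h4, h5, (h _ _).2 (Or.inl ⟨by omega, h6⟩)⟩
    · have h1 := h6.1
      have h2 := h6.2.1
      have h3 := h6.2.2.1
      refine ⟨by omega, by omega, by omega, by omega, (h _ _).2 (Or.inr ⟨?_, ?_⟩)⟩
      · exact (goodP_refl n k B hB i j h1 h2 (by omega)).1 h6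
      · intro a b hab h8 h9
        have h10 := hab.2.2.1
        have h11 := hab.1
        have h12 := hab.2.1
        have e1 : n + 1 - (n + 1 - a) = a := by omega
        have e2 : n + 1 - (n + 1 - b) = b := by omega
        have := h7 (n + 1 - b) (n + 1 - a)
          ((goodP_refl n k B hB _ _ (by omega) (by omega) (by omega)).2
            (by rw [e1, e2]; exact hab)) (by omega) (by omega)
        omega

lemma rstat_refl (n m : ℕ) (B : ℕ → ℕ → Prop) (hB : ValidP n B) (p : ℕ) (hp : 1 ≤ p)
    (hpn : p + 1 ≤ n) : RStat n m B p ↔ LStat m (reflP n B) (n - p) := by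
  constructor
  · rintro ⟨h1, h2⟩
    refine ⟨?_, ?_⟩
    · rintro a ⟨g1, g2, g3, g4, g5⟩
      have e : n + 1 - (n - p + 1) = p := by omega
      rw [e] at g5
      have := h1 _ g5
      omega
    · rcases h2 with h2 | ⟨a, b, h3, h4, h5, h6⟩ | ⟨a, b, h3, h4, h5⟩
      · left; omega
      · have hv := hB.1 _ _ h3
        exact Or.inr (Or.inl ⟨n + 1 - b, n + 1 - a,
          (refl_iff n B a b (by omega) (by omega) (by omega) (by omega)).2 h3,
          by omega, by omega, by omega⟩)
      · have hv := hB.1 _ _ h3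
        exact Or.inr (Or.inr ⟨n + 1 - b, n + 1 - a,
          (refl_iff n B a b (by omega) (by omega) (by omega) (by omega)).2 h3,
          by omega, by omega⟩)
  · rintro ⟨h1, h2⟩
    refine ⟨?_, ?_⟩
    · intro b hb
      have hv := hB.1 _ _ hb
      have e : n + 1 - p = n - p + 1 := by omega
      have := (refl_iff n B p b (by omega) (by omega) (by omega) (by omega)).2 hb
      rw [e] at this
      have := h1 _ this
      omega
    · rcases h2 with h2 | ⟨a, b, ⟨g1, g2, g3, g4, h3⟩, h4, h5, h6⟩ |
        ⟨a, b, ⟨g1, g2, g3, g4, h3⟩, h4, h5⟩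
      · left; omega
      · exact Or.inr (Or.inl ⟨_, _, h3, by omega, by omega, by omega⟩)
      · exact Or.inr (Or.inr ⟨_, _, h3, by omega, by omega⟩)

lemma rstat_step (n m : ℕ) (B B' : ℕ → ℕ → Prop) (hB : ValidP n B) (hB' : ValidP n B')
    (h : StepP n m B B')
    (p : ℕ) (hp : 1 ≤ p) (hpn : p + 1 ≤ n) : RStat n m B p ↔ RStat n (m + 1) B' p := by
  rw [rstat_refl n m B hB p hp hpn, rstat_refl n (m + 1) B' hB' p hp hpn]
  exact lstat_step n m _ _ (validP_refl n B hB) (stepP_refl n m B B' hB h) _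
    (by omega) (by omega)

section Root
variable {n : ℕ}

/-- Constructor for intervals. -/
def mkRoot (n i j : ℕ) (h1 : 1 ≤ i) (h2 : i < j) (h3 : j ≤ n) : RootPoset n :=
  ⟨(⟨i, by omega⟩, ⟨j, by omega⟩), h1, h2⟩

lemma root_valid (a : RootPoset n) : 1 ≤ a.fst ∧ a.fst < a.snd ∧ a.snd ≤ n :=
  ⟨a.2.1, a.2.2, Nat.lt_succ_iff.1 a.1.2.2⟩

lemma root_le (a b : RootPoset n) : a ≤ b ↔ b.fst ≤ a.fst ∧ a.snd ≤ b.snd := Iff.rfl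

lemma root_ext (a b : RootPoset n) (h1 : a.fst = b.fst) (h2 : a.snd = b.snd) : a = b :=
  le_antisymm ((root_le a b).2 ⟨h1.ge, h2.le⟩) ((root_le b a).2 ⟨h1.le, h2.ge⟩)

lemma rk_strictMono : StrictMono (RootPoset.rk (n := n)) := by
  intro a b h
  have hle := (root_le a b).1 h.le
  have ha := root_valid a
  have hb := root_valid b
  unfold RootPoset.rk
  by_contra hcon
  exact h.ne (root_ext a b (by omega) (by omega))

/-- The predicate on pairs attached to a set of intervals. -/
def toP (A : Finset (RootPoset n)) (i j : ℕ) : Prop := ∃ a ∈ A, a.fst = i ∧ a.snd = j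

lemma toP_valid (A : Finset (RootPoset n)) (hA : IsAntichain (· ≤ ·) (↑A : Set (RootPoset n))) :
    ValidP n (toP A) := by
  constructor
  · rintro i j ⟨a, _, rfl, rfl⟩
    exact root_valid a
  · rintro i j c d ⟨a, ha, rfl, rfl⟩ ⟨b, hb, rfl, rfl⟩ h1 h2
    have := hA.eq ha hb ⟨h1, h2⟩
    subst this
    exact ⟨rfl, rfl⟩

lemma good_toP (k : ℕ) (B : Finset (RootPoset n)) (x : RootPoset n) :
    GoodAt RootPoset.rk k B x ↔ GoodP n k (toP B) x.fst x.snd := by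
  have hx := root_valid x
  unfold GoodAt GoodP
  constructor
  · rintro ⟨h1, h2, h3⟩
    unfold RootPoset.rk at h1
    refine ⟨by omega, by omega, by omega, ?_, ?_⟩
    · rintro _ _ ⟨a, ha, rfl, rfl⟩ h4 h5
      have := root_valid a
      exact h2 a ha (by unfold RootPoset.rk; omega) h5
    · rintro _ _ ⟨a, ha, rfl, rfl⟩ h4 h5
      exact h3 a ha (by unfold RootPoset.rk; omega) h5
  · rintro ⟨h0, h0', h1, h2, h3⟩
    refine ⟨by unfold RootPoset.rk; omega, ?_, ?_⟩
    · intro f hf h4 h5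
      unfold RootPoset.rk at h4
      exact h2 _ _ ⟨f, hf, rfl, rfl⟩ (by omega) h5
    · intro f hf h4 h5
      have := root_valid f
      unfold RootPoset.rk at h4
      exact h3 _ _ ⟨f, hf, rfl, rfl⟩ (by omega) h5

lemma step_toP (k : ℕ) (B B' : Finset (RootPoset n))
    (h : ∀ x, x ∈ B' ↔ (x.rk < k ∧ x ∈ B) ∨ (k ≤ x.rk ∧ MinGood RootPoset.rk k B x)) :
    StepP n k (toP B) (toP B') := by
  intro i j
  constructor
  · rintro ⟨x, hx, rfl, rfl⟩
    have hv := root_valid x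
    rcases (h x).1 hx with ⟨h1, h2⟩ | ⟨h1, h2, h3⟩
    · left
      unfold RootPoset.rk at h1
      exact ⟨by omega, x, h2, rfl, rfl⟩
    · right
      refine ⟨(good_toP k B x).1 h2, ?_⟩
      intro a b hab h4 h5
      have g1 := hab.1
      have g2 := hab.2.1
      have g3 := hab.2.2.1
      have := h3 (mkRoot n a b g1 (by omega) g2) ((good_toP k B _).2 hab) ⟨h4, h5⟩
      rw [← this]
      exact ⟨rfl, rfl⟩
  · rintro (⟨h1, x, hx, rfl, rfl⟩ | ⟨h1, h2⟩)
    · have hv := root_valid x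
      exact ⟨x, (h x).2 (Or.inl ⟨by unfold RootPoset.rk; omega, hx⟩), rfl, rfl⟩
    · have g1 := h1.1
      have g2 := h1.2.1
      have g3 := h1.2.2.1
      have hg := (good_toP k B (mkRoot n i j g1 (by omega) g2)).2 h1
      refine ⟨mkRoot n i j g1 (by omega) g2, (h _).2 (Or.inr ⟨hg.1, hg, ?_⟩), rfl, rfl⟩
      intro y hy hle
      have := h2 _ _ ((good_toP k B y).1 hy) hle.1 hle.2
      exact root_ext _ _ this.1 this.2

lemma rvac_main (N : ℕ) (hN : ∀ x : RootPoset n, x.rk ≤ N) (A : Finset (RootPoset n))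
    (hA : IsAntichain (· ≤ ·) (↑A : Set (RootPoset n))) (m : ℕ) (hm : m ≤ N + 1) :
    ∃ C, C = (List.range m).foldl (fun B k => (List.range' k (N + 1 - k)).foldl
        (fun C j => rankToggle RootPoset.rk j C) B) A ∧
      IsAntichain (· ≤ ·) (↑C : Set (RootPoset n)) ∧
      ∀ p, 1 ≤ p → p + 1 ≤ n →
        ((LStat 0 (toP A) p ↔ LStat m (toP C) p) ∧
         (RStat n 0 (toP A) p ↔ RStat n m (toP C) p)) := by
  induction m with
  | zero => exact ⟨A, rfl, hA, fun _ _ _ => ⟨Iff.rfl, Iff.rfl⟩⟩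
  | succ m ih =>
    obtain ⟨C, hC, hanti, hst⟩ := ih (by omega)
    obtain ⟨s1, s2⟩ := sweep_spec RootPoset.rk rk_strictMono m (N + 1 - m) C hanti
    refine ⟨_, rfl, ?_⟩
    rw [List.range_succ, List.foldl_append, List.foldl_cons, List.foldl_nil, ← hC]
    refine ⟨s1, ?_⟩
    have hstep := step_toP m C _ (fun x => (s2 x).trans (by
      have := hN x
      constructor
      · rintro (h | h | h)
        · exact Or.inl h
        · exact Or.inr ⟨h.1, h.2.2⟩
        · omega
      · rintro (h | h)
        · exact Or.inl h
        · exact Or.inr (Or.inl ⟨h.1, by omega, h.2⟩)))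
    intro p hp hpn
    have hV := toP_valid C hanti
    have hV' := toP_valid _ s1
    rw [(hst p hp hpn).1, (hst p hp hpn).2]
    exact ⟨lstat_step n m _ _ hV hstep p hp hpn, rstat_step n m _ _ hV hV' hstep p hp hpn⟩

lemma pair_formula (C : Finset (RootPoset n))
    (hC : IsAntichain (· ≤ ·) (↑C : Set (RootPoset n))) (S T : Finset ℕ) (r : ℕ)
    (hS : S.card = r) (hT : T.card = r)
    (h1 : ∀ p, p ∈ S ↔ ∃ c ∈ C, c.fst = p) (h2 : ∀ c ∈ C, c.snd ∈ T) :
    C.image (fun a => (a.fst, a.snd)) =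
      Finset.image (fun l : Fin r => (S.orderEmbOfFin hS l, T.orderEmbOfFin hT l))
        Finset.univ := by
  have hinj : ∀ a ∈ C, ∀ b ∈ C, a.fst = b.fst → a = b := by
    intro a ha b hb hab
    rcases le_total a.snd b.snd with h | h
    · exact hC.eq ha hb ⟨hab.ge, h⟩
    · exact (hC.eq hb ha ⟨hab.le, h⟩).symm
  have hex : ∀ l : Fin r, ∃ c ∈ C, c.fst = S.orderEmbOfFin hS l := fun l =>
    (h1 _).1 (Finset.orderEmbOfFin_mem S hS l)
  choose c hc hcf using hex
  have hmono : StrictMono (fun l => (c l).snd) := by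
    intro l l' hl
    by_contra hcon
    have hlt := (S.orderEmbOfFin hS).strictMono hl
    rw [← hcf, ← hcf] at hlt
    have := hC.eq (hc l') (hc l) ⟨hlt.le, not_lt.1 hcon⟩
    rw [this] at hlt
    exact lt_irrefl _ hlt
  have heq := Finset.orderEmbOfFin_unique hT (fun l => h2 _ (hc l)) hmono
  have hsnd : ∀ l, (c l).snd = T.orderEmbOfFin hT l := fun l => congrFun heq l
  ext ⟨i, j⟩
  simp only [Finset.mem_image, Finset.mem_univ, true_and, Prod.mk.injEq]
  constructor
  · rintro ⟨a, ha, rfl, rfl⟩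
    have hmem : a.fst ∈ Set.range (S.orderEmbOfFin hS) := by
      rw [Finset.range_orderEmbOfFin]
      exact (h1 _).2 ⟨a, ha, rfl⟩
    obtain ⟨l, hl⟩ := hmem
    refine ⟨l, hl, ?_⟩
    rw [← hsnd, hinj _ (hc l) a ha ((hcf l).trans hl)]
  · rintro ⟨l, rfl, rfl⟩
    exact ⟨c l, hc l, hcf l, hsnd l⟩

lemma lstat_zero (A : Finset (RootPoset n)) (p : ℕ) (hp : 1 ≤ p) :
    LStat 0 (toP A) p ↔ ∃ a ∈ A, a.fst = p := by
  constructor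
  · rintro ⟨_, h | ⟨_, _, ⟨a, ha, rfl, rfl⟩, h, _⟩ | ⟨_, _, ⟨a, ha, rfl, rfl⟩, _, h⟩⟩
    · omega
    · have := root_valid a; omega
    · exact ⟨a, ha, h⟩
  · rintro ⟨a, ha, rfl⟩
    have hv := root_valid a
    refine ⟨?_, Or.inr (Or.inr ⟨a.fst, a.snd, ⟨a, ha, rfl, rfl⟩, by omega, rfl⟩)⟩
    rintro _ ⟨b, hb, rfl, h⟩
    have := root_valid b; omega

lemma rstat_zero (A : Finset (RootPoset n)) (p : ℕ) (hp : p + 1 ≤ n) :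
    RStat n 0 (toP A) p ↔ ∃ a ∈ A, a.snd = p + 1 := by
  constructor
  · rintro ⟨_, h | ⟨_, _, ⟨a, ha, rfl, rfl⟩, h, _⟩ | ⟨_, _, ⟨a, ha, rfl, rfl⟩, _, h⟩⟩
    · omega
    · have := root_valid a; omega
    · exact ⟨a, ha, h⟩
  · rintro ⟨a, ha, h⟩
    have hv := root_valid a
    refine ⟨?_, Or.inr (Or.inr ⟨a.fst, a.snd, ⟨a, ha, rfl, rfl⟩, by omega, by omega⟩)⟩
    rintro _ ⟨b, hb, h, rfl⟩
    have := root_valid b; omega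

lemma lstat_top (C : Finset (RootPoset n)) (m p : ℕ) (hm : n ≤ m + 1) (hp : p + 1 ≤ n) :
    LStat m (toP C) p ↔ ¬ ∃ a ∈ C, a.snd = p + 1 := by
  constructor
  · rintro ⟨h, _⟩ ⟨a, ha, h'⟩
    have := h a.fst ⟨a, ha, rfl, h'⟩
    have := root_valid a; omega
  · intro h
    refine ⟨?_, Or.inl (by omega)⟩
    rintro _ ⟨a, ha, _, h'⟩
    exact absurd ⟨a, ha, h'⟩ h

lemma rstat_top (C : Finset (RootPoset n)) (m p : ℕ) (hm : n ≤ m + 1) (hp : 1 ≤ p) :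
    RStat n m (toP C) p ↔ ¬ ∃ a ∈ C, a.fst = p := by
  constructor
  · rintro ⟨h, _⟩ ⟨a, ha, h'⟩
    have := h a.snd ⟨a, ha, h', rfl⟩
    have := root_valid a; omega
  · intro h
    refine ⟨?_, Or.inl (by omega)⟩
    rintro _ ⟨a, ha, h', _⟩
    exact absurd ⟨a, ha, h'⟩ h

end Root

/-- The Lalanne–Kreweras description of rowvacuation in type `A_{n-1}`: for an
antichain `A = {[i₁,j₁],…,[i_k,j_k]}`, `Rvac A` is the antichain whose left
endpoints are the increasing enumeration of `{1,…,n-1} \ {jₗ - 1}` and whose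
right endpoints are the increasing enumeration of `{2,…,n} \ {iₗ + 1}`, paired
in order.  (Antichains are compared via their images in `ℕ × ℕ`.) -/
theorem rvac_typeA_formula (n k : ℕ) (A : Finset (RootPoset n))
    (hA : IsAntichain (· ≤ ·) (↑A : Set (RootPoset n))) (hk : A.card = k)
    (hS : ((Finset.Icc 1 (n - 1)) \ A.image (fun a => a.snd - 1)).card = n - 1 - k)
    (hT : ((Finset.Icc 2 n) \ A.image (fun a => a.fst + 1)).card = n - 1 - k) :
    (rvac (RootPoset.rk (n := n)) (Finset.univ.sup (RootPoset.rk (n := n))) A).image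
        (fun a => (a.fst, a.snd)) =
      Finset.image
        (fun ℓ : Fin (n - 1 - k) =>
          ((((Finset.Icc 1 (n - 1)) \ A.image (fun a => a.snd - 1)).orderEmbOfFin hS ℓ : ℕ),
           (((Finset.Icc 2 n) \ A.image (fun a => a.fst + 1)).orderEmbOfFin hT ℓ : ℕ)))
        Finset.univ := by
  have hN : ∀ x : RootPoset n, x.rk ≤ Finset.univ.sup (RootPoset.rk (n := n)) :=
    fun x => Finset.le_sup (f := RootPoset.rk (n := n)) (Finset.mem_univ x)
  have hn : n ≤ Finset.univ.sup (RootPoset.rk (n := n)) + 1 + 1 := by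
    by_cases h2 : 2 ≤ n
    · have := hN (mkRoot n 1 n le_rfl (by omega) le_rfl)
      have e : (mkRoot n 1 n le_rfl (by omega) le_rfl).rk = n - 1 - 1 := rfl
      omega
    · omega
  obtain ⟨C, hC, hanti, hst⟩ := rvac_main _ hN A hA _ le_rfl
  have e : rvac (RootPoset.rk (n := n)) (Finset.univ.sup (RootPoset.rk (n := n))) A = C :=
    hC.symm
  rw [e]
  apply pair_formula C hanti
  · intro p
    simp only [Finset.mem_sdiff, Finset.mem_Icc, Finset.mem_image]
    constructor
    · rintro ⟨⟨h1, h2⟩, h3⟩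
      have := (hst p h1 (by omega)).2
      rw [rstat_zero A p (by omega), rstat_top C _ p hn h1] at this
      by_contra hcon
      obtain ⟨a, ha, h⟩ := this.2 hcon
      exact h3 ⟨a, ha, by omega⟩
    · rintro ⟨c, hc, rfl⟩
      have hv := root_valid c
      have := (hst c.fst hv.1 (by omega)).2
      rw [rstat_zero A _ (by omega), rstat_top C _ _ hn hv.1] at this
      refine ⟨⟨by omega, by omega⟩, ?_⟩
      rintro ⟨a, ha, h⟩
      have hva := root_valid a
      exact this.1 ⟨a, ha, by omega⟩ ⟨c, hc, rfl⟩
  · intro c hc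
    have hv := root_valid c
    simp only [Finset.mem_sdiff, Finset.mem_Icc, Finset.mem_image]
    refine ⟨⟨by omega, by omega⟩, ?_⟩
    rintro ⟨a, ha, h⟩
    have hva := root_valid a
    have := (hst a.fst hva.1 (by omega)).1
    rw [lstat_zero A _ hva.1, lstat_top C _ _ hn (by omega)] at this
    exact this.1 ⟨a, ha, rfl⟩ ⟨c, hc, h.symm⟩
end

section
/- For every antichain A of the type A_{n-1} root poset (intervals [i,j] ⊆ [n] ordered by containment), we have #A + #Rvac(A) = n − 1. -/
open scoped Classical

variable {α : Type*}

theorem mem_foldr_toggle {β : Type*} [PartialOrder β] (C : Finset β)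
    (hC : IsAntichain (· ≤ ·) (↑C : Set β)) (l : List β) (hn : l.Nodup)
    (hl : ∀ a ∈ l, ∀ b ∈ l, a ≤ b → a = b) :
    IsAntichain (· ≤ ·) (↑(l.foldr toggle C) : Set β) ∧
    ∀ x, x ∈ l.foldr toggle C ↔
      (x ∉ l ∧ x ∈ C) ∨ (x ∈ l ∧ ∀ c ∈ C, ¬ x ≤ c ∧ ¬ c ≤ x) := by
  induction l with
  | nil => simpa using hC
  | cons p l ih =>
    obtain ⟨hp, hn⟩ := List.nodup_cons.1 hn
    obtain ⟨ihA, ihm⟩ := ih hn (fun a ha b hb => hl a (by simp [ha]) b (by simp [hb]))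
    have hinc : ∀ a ∈ l, ¬ p ≤ a ∧ ¬ a ≤ p := by
      intro a ha
      constructor
      · intro h
        have := hl p (by simp) a (by simp [ha]) h
        exact hp (this ▸ ha)
      · intro h
        have := hl a (by simp [ha]) p (by simp) h
        exact hp (this ▸ ha)
    rw [List.foldr_cons]
    set D := l.foldr toggle C with hD
    have hpD : p ∈ D ↔ p ∈ C := by rw [ihm]; simp [hp]
    unfold toggle
    split_ifs with h1 h2
    · refine ⟨ihA.subset (by simp), ?_⟩
      intro x
      rw [Finset.mem_erase, ihm, List.mem_cons]
      by_cases hx : x = p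
      · subst hx
        have := hpD.1 h1
        simp only [ne_eq, not_true_eq_false, false_and, true_or, true_and, false_or, false_iff]
        intro h
        exact (h x this).1 le_rfl
      · simp [hx]
    · refine ⟨h2, ?_⟩
      intro x
      rw [Finset.mem_insert, ihm, List.mem_cons]
      by_cases hx : x = p
      · subst hx
        simp only [true_or, true_and, not_true_eq_false, false_and, false_or, true_iff]
        intro c hc
        by_cases hcl : c ∈ l
        · exact hinc c hcl
        · have hcD : c ∈ D := (ihm c).2 (Or.inl ⟨hcl, hc⟩)
          have hne : x ≠ c := fun h => h1 (h ▸ hcD)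
          exact ⟨h2 (by simp) (by simp [hcD]) hne, h2 (by simp [hcD]) (by simp) hne.symm⟩
      · simp [hx]
    · refine ⟨ihA, ?_⟩
      intro x
      rw [ihm, List.mem_cons]
      by_cases hx : x = p
      · subst hx
        have hxC : x ∉ C := fun h => h1 (hpD.2 h)
        simp only [hp, hxC, true_or, true_and, not_true_eq_false, false_and, false_or, and_false,
          false_iff]
        intro h
        apply h2
        rw [Finset.coe_insert, isAntichain_insert]
        refine ⟨ihA, ?_⟩
        intro b hb _
        have hb' := (ihm b).1 hb
        rcases hb' with ⟨_, hb'⟩ | ⟨hb', _⟩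
        · exact h b hb'
        · exact hinc b hb'
      · simp [hx]

namespace RootPoset

theorem le_iff {n : ℕ} (a b : RootPoset n) : a ≤ b ↔ b.fst ≤ a.fst ∧ a.snd ≤ b.snd := Iff.rfl

theorem bd {n : ℕ} (a : RootPoset n) : 1 ≤ a.fst ∧ a.fst < a.snd ∧ a.snd ≤ n :=
  ⟨a.2.1, a.2.2, Nat.lt_succ_iff.1 a.1.2.2⟩

theorem ext' {n : ℕ} {a b : RootPoset n} (h1 : a.fst = b.fst) (h2 : a.snd = b.snd) : a = b :=
  le_antisymm ((le_iff a b).2 ⟨h1.ge, h2.le⟩) ((le_iff b a).2 ⟨h1.le, h2.ge⟩)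

theorem exists_mk {n : ℕ} (i j : ℕ) (h1 : 1 ≤ i) (h2 : i < j) (h3 : j ≤ n) :
    ∃ a : RootPoset n, a.fst = i ∧ a.snd = j :=
  ⟨⟨(⟨i, by omega⟩, ⟨j, by omega⟩), h1, h2⟩, rfl, rfl⟩

theorem rk_eq {n : ℕ} (a : RootPoset n) : a.rk + a.fst + 1 = a.snd := by
  have := a.bd; unfold rk; omega

theorem rk_mono {n : ℕ} {a b : RootPoset n} (h : a ≤ b) : a.rk ≤ b.rk := by
  have := a.rk_eq; have := b.rk_eq; have := (le_iff a b).1 h; omega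

theorem eq_of_le {n : ℕ} {a b : RootPoset n} (h : a ≤ b) (hr : a.rk = b.rk) : a = b := by
  have := a.rk_eq; have := b.rk_eq; have := (le_iff a b).1 h
  exact ext' (by omega) (by omega)

theorem rk_strict {n : ℕ} {a b : RootPoset n} (h : a < b) : a.rk < b.rk := by
  rcases (rk_mono h.le).lt_or_eq with h' | h'
  · exact h'
  · exact absurd (eq_of_le h.le h') h.ne

theorem rankToggle_spec {n : ℕ} (j : ℕ) (C : Finset (RootPoset n))
    (hC : IsAntichain (· ≤ ·) (↑C : Set (RootPoset n))) :
    IsAntichain (· ≤ ·) (↑(rankToggle rk j C) : Set (RootPoset n)) ∧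
    ∀ x, x ∈ rankToggle rk j C ↔
      (rk x ≠ j ∧ x ∈ C) ∨ (rk x = j ∧ ∀ c ∈ C, ¬ x ≤ c ∧ ¬ c ≤ x) := by
  have := mem_foldr_toggle C hC (Finset.univ.filter (fun p : RootPoset n => rk p = j)).toList
    (Finset.nodup_toList _) (by
      intro a ha b hb hab
      simp at ha hb
      exact eq_of_le hab (by omega))
  simpa [rankToggle] using this

theorem block_spec {n : ℕ} (k m : ℕ) (S : Finset (RootPoset n))
    (hS : IsAntichain (· ≤ ·) (↑S : Set (RootPoset n))) (T : Finset (RootPoset n))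
    (hT : T = (List.range' k m).foldl (fun C j => rankToggle rk j C) S) :
    IsAntichain (· ≤ ·) (↑T : Set (RootPoset n)) ∧
    (∀ x, (rk x < k ∨ k + m ≤ rk x) → (x ∈ T ↔ x ∈ S)) ∧
    (∀ x, k ≤ rk x → rk x < k + m →
      (x ∈ T ↔ (∀ s ∈ S, ¬ x ≤ s) ∧ ∀ t ∈ T, ¬ t < x)) := by
  induction m generalizing T with
  | zero =>
    simp at hT
    subst hT
    exact ⟨hS, fun _ _ => Iff.rfl, fun x h1 h2 => by omega⟩
  | succ m ih =>
    rw [List.range'_1_concat, List.foldl_append] at hT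
    obtain ⟨hD, h1, h2⟩ := ih _ rfl
    set D := (List.range' k m).foldl (fun C j => rankToggle rk j C) S with hDd
    simp only [List.foldl_cons, List.foldl_nil] at hT
    obtain ⟨hTA, hm⟩ := rankToggle_spec (k + m) D hD
    rw [← hT] at hTA hm
    have hne : ∀ x, rk x ≠ k + m → (x ∈ T ↔ x ∈ D) := by
      intro x hx
      rw [hm]; simp [hx]
    refine ⟨hTA, ?_, ?_⟩
    · intro x hx
      rw [hne x (by omega), h1 x (by omega)]
    · intro x hx1 hx2
      by_cases hx : rk x = k + m
      · rw [hm]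
        simp only [hx, ne_eq, not_true_eq_false, false_and, true_and, false_or]
        constructor
        · intro h
          constructor
          · intro s hs hxs
            have := rk_mono hxs
            exact (h s ((h1 s (by omega)).2 hs)).1 hxs
          · intro t ht htx
            have := rk_strict htx
            exact (h t ((hne t (by omega)).1 ht)).2 htx.le
        · rintro ⟨ha, hb⟩ c hc
          have key : ¬ x ≤ c := by
            intro hxc
            have := rk_mono hxc
            exact ha c ((h1 c (by omega)).1 hc) hxc
          refine ⟨key, fun hcx => ?_⟩
          have hlt : c < x := lt_of_le_not_ge hcx key
          have := rk_strict hlt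
          exact hb c ((hne c (by omega)).2 hc) hlt
      · rw [hne x hx, h2 x hx1 (by omega)]
        refine and_congr_right fun _ => ?_
        constructor
        · intro h t ht htx
          have := rk_strict htx
          exact h t ((hne t (by omega)).1 ht) htx
        · intro h t ht htx
          have := rk_strict htx
          exact h t ((hne t (by omega)).2 ht) htx

theorem main_spec {n : ℕ} (N : ℕ) (hN : ∀ x : RootPoset n, rk x ≤ N) (d k : ℕ)
    (hk : k + d = N + 1) (S : Finset (RootPoset n))
    (hS : IsAntichain (· ≤ ·) (↑S : Set (RootPoset n))) (F : Finset (RootPoset n))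
    (hF : F = (List.range' k d).foldl
      (fun B k => (List.range' k (N + 1 - k)).foldl (fun C j => rankToggle rk j C) B) S) :
    IsAntichain (· ≤ ·) (↑F : Set (RootPoset n)) ∧
    (∀ x, rk x < k → (x ∈ F ↔ x ∈ S)) ∧
    (∀ p : RootPoset n, rk p = k → (∀ s ∈ S, rk s < k → ¬ s ≤ p) →
      ((∃ f ∈ F, k ≤ rk f ∧ f.fst = p.fst) ↔ ¬ ∃ q ∈ S, k ≤ rk q ∧ q.snd = p.snd)) := by
  induction d generalizing k S with
  | zero =>
    simp at hF
    subst hF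
    refine ⟨hS, fun _ _ => Iff.rfl, fun p hp => ?_⟩
    have := hN p
    omega
  | succ d ih =>
    rw [List.range'_succ, List.foldl_cons] at hF
    obtain ⟨hTA, hT1, hT2⟩ := block_spec k (N + 1 - k) S hS _ rfl
    set T := (List.range' k (N + 1 - k)).foldl (fun C j => rankToggle rk j C) S with hTd
    obtain ⟨hFA, hF1, hF2⟩ := ih (k + 1) (by omega) T hTA hF
    have hlow : ∀ x, rk x < k → (x ∈ T ↔ x ∈ S) := fun x hx => hT1 x (Or.inl hx)
    have hhi : ∀ x, k ≤ rk x → (x ∈ T ↔ (∀ s ∈ S, ¬ x ≤ s) ∧ ∀ t ∈ T, ¬ t < x) :=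
      fun x hx => hT2 x hx (by have := hN x; omega)
    refine ⟨hFA, fun x hx => by rw [hF1 x (by omega), hlow x hx], ?_⟩
    intro p hp hpS
    have hpr := p.rk_eq
    have hpb := p.bd
    have hTlt : ∀ t ∈ T, ¬ t < p := by
      intro t ht htp
      have := rk_strict htp
      exact hpS t ((hlow t (by omega)).1 ht) (by omega) htp.le
    by_cases hpT : p ∈ T
    · have hpF : p ∈ F := (hF1 p (by omega)).2 hpT
      refine iff_of_true ⟨p, hpF, hp.ge, rfl⟩ ?_
      rintro ⟨q, hq, hqk, hqs⟩
      have := q.rk_eq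
      exact ((hhi p hp.ge).1 hpT).1 q hq ⟨by omega, by omega⟩
    · have hpF : p ∉ F := fun h => hpT ((hF1 p (by omega)).1 h)
      have hq0 : ∃ q ∈ S, p ≤ q := by
        by_contra hcon
        push Not at hcon
        exact hpT ((hhi p hp.ge).2 ⟨hcon, hTlt⟩)
      obtain ⟨q0, hq0S, hpq0⟩ := hq0
      have hq0' := (le_iff _ _).1 hpq0
      have hq0b := q0.bd
      have hleft : (∃ f ∈ F, k ≤ rk f ∧ f.fst = p.fst) ↔
          (∃ f ∈ F, k + 1 ≤ rk f ∧ f.fst = p.fst) := by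
        constructor
        · rintro ⟨f, hf, hfk, hfp⟩
          refine ⟨f, hf, ?_, hfp⟩
          rcases hfk.lt_or_eq with h | h
          · exact h
          · exfalso
            have := f.rk_eq
            have : f = p := ext' hfp (by omega)
            exact hpF (this ▸ hf)
        · rintro ⟨f, hf, hfk, hfp⟩
          exact ⟨f, hf, by omega, hfp⟩
      rw [hleft]
      by_cases hgood : ∃ p' : RootPoset n, p'.fst = p.fst ∧ p'.snd = p.snd + 1 ∧
          ∀ t ∈ T, rk t < k + 1 → ¬ t ≤ p'
      · obtain ⟨p', hp1, hp2, hp3⟩ := hgood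
        have hp'r := p'.rk_eq
        have hp'b := p'.bd
        have := hF2 p' (by omega) hp3
        rw [hp1, hp2] at this
        rw [this]
        refine not_congr ?_
        constructor
        · rintro ⟨q, hqT, hqk, hqs⟩
          have hqr := q.rk_eq
          have hqb := q.bd
          obtain ⟨hqa, hqt⟩ := (hhi q (by omega)).1 hqT
          obtain ⟨y, hy1, hy2⟩ := exists_mk (n := n) q.fst p.snd (by omega) (by omega) (by omega)
          have hyr := y.rk_eq
          have hyq : y < q := lt_of_le_not_ge ⟨by omega, by omega⟩
            (fun h => by have := (le_iff _ _).1 h; omega)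
          have hyT : y ∉ T := fun h => hqt y h hyq
          have : ∃ s ∈ S, y ≤ s := by
            by_contra hcon
            push Not at hcon
            exact hyT ((hhi y (by omega)).2 ⟨hcon, fun t ht hty => hqt t ht (hty.trans hyq)⟩)
          obtain ⟨s, hs, hys⟩ := this
          have hys' := (le_iff _ _).1 hys
          have hsr := s.rk_eq
          refine ⟨s, hs, by omega, ?_⟩
          by_contra hne
          exact hqa s hs ⟨by omega, by omega⟩
        · rintro ⟨q, hqS, hqk, hqs⟩
          have hqr := q.rk_eq
          have hqb := q.bd
          let P : ℕ → Prop := fun x => x ≤ p.fst ∧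
            ∃ y : RootPoset n, y.fst = x ∧ y.snd = p.snd + 1 ∧ ∀ s ∈ S, ¬ y ≤ s
          have hPq : P q.fst := by
            refine ⟨by omega, ?_⟩
            obtain ⟨y, hy1, hy2⟩ :=
              exists_mk (n := n) q.fst (p.snd + 1) (by omega) (by omega) (by omega)
            refine ⟨y, hy1, hy2, fun s hs hys => ?_⟩
            have hys' := (le_iff _ _).1 hys
            have hqs' : q ≤ s := ⟨by omega, by omega⟩
            have : q = s := hS.eq hqS hs hqs'
            subst this
            omega
          have hle : q.fst ≤ p.fst := by omega
          obtain ⟨hx1, y, hy1, hy2, hy3⟩ := Nat.findGreatest_spec (P := P) hle hPq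
          have hgr : q.fst ≤ Nat.findGreatest P p.fst := Nat.le_findGreatest hle hPq
          have hmax : ∀ z, Nat.findGreatest P p.fst < z → z ≤ p.fst → ¬ P z :=
            fun z h1 h2 => Nat.findGreatest_is_greatest h1 h2
          have hyr := y.rk_eq
          refine ⟨y, (hhi y (by omega)).2 ⟨hy3, ?_⟩, by omega, hy2⟩
          intro t ht hty
          have htr := t.rk_eq
          have htb := t.bd
          have hty' := (le_iff _ _).1 hty.le
          have htlt := rk_strict hty
          by_cases hd : t.snd ≤ p.snd
          · have htq : t ≤ q := ⟨by omega, by omega⟩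
            by_cases htk : k ≤ rk t
            · exact ((hhi t htk).1 ht).1 q hqS htq
            · have htS := (hlow t (by omega)).1 ht
              have : t = q := hS.eq htS hqS htq
              subst this
              omega
          · by_cases hc : t.fst ≤ p.fst
            · refine hmax t.fst (by omega) hc ⟨hc, t, rfl, by omega, ?_⟩
              exact ((hhi t (by omega)).1 ht).1
            · exact hp3 t ht (by omega) ⟨by omega, by omega⟩
      · refine iff_of_false ?_ ?_
        · rintro ⟨f, hf, hfk, hfp⟩
          have hfr := f.rk_eq
          have hfb := f.bd
          obtain ⟨y, hy1, hy2⟩ :=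
            exists_mk (n := n) p.fst (p.snd + 1) (by omega) (by omega) (by omega)
          refine hgood ⟨y, hy1, hy2, fun t ht htk hty => ?_⟩
          have hty' := (le_iff _ _).1 hty
          have htF := (hF1 t htk).2 ht
          have : t = f := hFA.eq htF hf ⟨by omega, by omega⟩
          subst this
          omega
        · rw [not_not]
          refine ⟨q0, hq0S, by have := rk_mono hpq0; omega, ?_⟩
          by_contra hne
          obtain ⟨y, hy1, hy2⟩ :=
            exists_mk (n := n) p.fst (p.snd + 1) (by omega) (by omega) (by omega)
          refine hgood ⟨y, hy1, hy2, fun t ht htk hty => ?_⟩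
          have hty' := (le_iff _ _).1 hty
          have htq : t ≤ q0 := ⟨by omega, by omega⟩
          by_cases hk' : k ≤ rk t
          · exact ((hhi t hk').1 ht).1 q0 hq0S htq
          · have htS := (hlow t (by omega)).1 ht
            have : t = q0 := hS.eq htS hq0S htq
            subst this
            have := rk_mono hpq0
            omega

end RootPoset

theorem rvac_typeA_card (n : ℕ) (A : Finset (RootPoset n))
    (hA : IsAntichain (· ≤ ·) (↑A : Set (RootPoset n))) :
    A.card + (rvac (RootPoset.rk (n := n)) (Finset.univ.sup (RootPoset.rk (n := n))) A).card = n - 1 := by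
  obtain ⟨hFA, -, h⟩ := RootPoset.main_spec (n := n) (Finset.univ.sup (RootPoset.rk (n := n)))
    (fun x => Finset.le_sup (f := RootPoset.rk) (Finset.mem_univ x))
    (Finset.univ.sup (RootPoset.rk (n := n)) + 1) 0 (by omega) A hA
    (rvac (RootPoset.rk (n := n)) (Finset.univ.sup (RootPoset.rk (n := n))) A)
    (by rw [rvac, List.range_eq_range'])
  set F := rvac (RootPoset.rk (n := n)) (Finset.univ.sup (RootPoset.rk (n := n))) A with hF
  have c1 : (A.image (fun a => a.snd - 1)).card = A.card := by
    refine Finset.card_image_of_injOn ?_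
    intro a ha b hb hab
    simp only at hab
    have h1 := a.bd
    have h2 := b.bd
    rcases le_total a.fst b.fst with h' | h'
    · exact (hA.eq hb ha ⟨h', by omega⟩).symm
    · exact hA.eq ha hb ⟨h', by omega⟩
  have c2 : (F.image (fun a => a.fst)).card = F.card := by
    refine Finset.card_image_of_injOn ?_
    intro a ha b hb hab
    simp only at hab
    rcases le_total a.snd b.snd with h' | h'
    · exact hFA.eq ha hb ⟨by omega, h'⟩
    · exact (hFA.eq hb ha ⟨by omega, h'⟩).symm
  have key : F.image (fun a => a.fst) = Finset.Icc 1 (n - 1) \ A.image (fun a => a.snd - 1) := by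
    ext i
    simp only [Finset.mem_image, Finset.mem_sdiff, Finset.mem_Icc]
    by_cases hi : 1 ≤ i ∧ i ≤ n - 1
    · obtain ⟨p, hp1, hp2⟩ := RootPoset.exists_mk (n := n) i (i + 1) hi.1 (by omega) (by omega)
      have hpr := p.rk_eq
      have := h p (by omega) (by intro s _ hs; omega)
      simp only [Nat.zero_le, true_and, hp1, hp2] at this
      rw [this]
      simp only [hi, and_self, true_and]
      refine not_congr (exists_congr fun a => and_congr_right fun _ => ?_)
      have := a.bd
      omega
    · refine iff_of_false ?_ (fun h => hi h.1)
      rintro ⟨a, _, ha⟩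
      have := a.bd
      omega
  have hsub : A.image (fun a => a.snd - 1) ⊆ Finset.Icc 1 (n - 1) := by
    intro i hi
    obtain ⟨a, _, ha⟩ := Finset.mem_image.1 hi
    have := a.bd
    rw [Finset.mem_Icc]
    omega
  have hc := Finset.card_sdiff_add_card_eq_card hsub
  rw [← key, c1, c2, Nat.card_Icc] at hc
  omega
end

section
/- Let P be a finite ranked poset. If there is a constant c ∈ ℕ with #A + #Rvac(A) = c for every antichain A of P, then the average cardinality of antichains along every rowmotion orbit O is c/2, i.e., Σ_{A∈O} #A = (c/2)·#O. -/
open scoped Classical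

variable {α : Type*}

section Helpers

variable [Fintype α] [PartialOrder α]

/-- `p` lies in the order ideal generated by the `k`-th rowmotion iterate of `C`. -/
def dnI (C : Finset α) (k : ℕ) (p : α) : Prop := ∃ a ∈ rowmotion^[k] C, p ≤ a

theorem dnI_mono {C : Finset α} {k : ℕ} {p q : α} (h : dnI C k p) (hq : q ≤ p) : dnI C k q := by
  obtain ⟨a, ha, hpa⟩ := h
  exact ⟨a, ha, hq.trans hpa⟩

theorem mem_row_iff (C : Finset α) (k : ℕ) (p : α) :
    p ∈ rowmotion^[k+1] C ↔ ¬ dnI C k p ∧ ∀ q, q < p → dnI C k q := by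
  rw [Function.iterate_succ_apply']
  unfold rowmotion dnI
  simp only [Finset.mem_filter, Finset.mem_univ, true_and]
  constructor
  · rintro ⟨h1, h2⟩
    refine ⟨?_, ?_⟩
    · rintro ⟨a, ha, hpa⟩
      exact h1 a ha hpa
    · intro q hq
      by_contra hcon
      push Not at hcon
      exact hq.ne (h2 q hcon hq.le)
  · rintro ⟨h1, h2⟩
    refine ⟨fun y hy hpy => h1 ⟨y, hy, hpy⟩, ?_⟩
    intro z hz hzp
    by_contra hne
    obtain ⟨a, ha, hza⟩ := h2 z (lt_of_le_of_ne hzp hne)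
    exact hz a ha hza

theorem mem_row_iff' (C : Finset α) (k : ℕ) (p : α) :
    p ∈ rowmotion^[k+1] C ↔ dnI C (k+1) p ∧ ¬ dnI C k p := by
  constructor
  · intro h
    exact ⟨⟨p, h, le_rfl⟩, ((mem_row_iff C k p).1 h).1⟩
  · rintro ⟨⟨a, ha, hpa⟩, h2⟩
    rcases hpa.eq_or_lt with h | h
    · rw [h]; exact ha
    · exact absurd (((mem_row_iff C k a).1 ha).2 p h) h2

theorem dnI_pred {C : Finset α} {k : ℕ} {p q : α} (h : dnI C (k+1) p) (hq : q < p) :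
    dnI C k q := by
  obtain ⟨a, ha, hpa⟩ := h
  exact ((mem_row_iff C k a).1 ha).2 q (hq.trans_le hpa)

theorem exists_lower {rk : α → ℕ} (hrk : IsRankFunction rk) {q p : α} (h : q < p) :
    ∃ x, q ≤ x ∧ x < p ∧ rk p = rk x + 1 := by
  obtain ⟨x, h1, h2⟩ := exists_le_covBy_of_lt h
  exact ⟨x, h1, h2.lt, hrk.2 _ _ h2⟩

theorem rk_strict {rk : α → ℕ} (hrk : IsRankFunction rk) : ∀ {p q : α}, q < p → rk q < rk p := by
  intro p
  induction p using WellFoundedLT.induction with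
  | _ p ih =>
    intro q h
    obtain ⟨x, h1, h2, h3⟩ := exists_lower hrk h
    rcases h1.eq_or_lt with h | h
    · subst h; omega
    · have := ih x h2 h; omega

theorem dnI_descend {rk : α → ℕ} (hrk : IsRankFunction rk) (C : Finset α) (s : ℕ) (q : α) :
    ∀ (d : ℕ) (p : α), dnI C (s + d) p → q ≤ p → rk q + d ≤ rk p → dnI C s q := by
  intro d
  induction d with
  | zero => intro p hp hq _; exact dnI_mono hp hq
  | succ d ih =>
    intro p hp hq hr
    rcases hq.eq_or_lt with h | h
    · subst h; omega
    · obtain ⟨x, h1, h2, h3⟩ := exists_lower hrk h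
      exact ih x (dnI_pred hp h2) h1 (by omega)

/-- The state after `k` passes of rowvacuation started at `rowmotion C`. -/
def BB (rk : α → ℕ) (C : Finset α) (k : ℕ) (p : α) : Prop :=
  if rk p < k then dnI C (rk p) p ∧ ¬ dnI C (rk p + 1) p else p ∈ rowmotion^[k+1] C

theorem BB_exists {rk : α → ℕ} (hrk : IsRankFunction rk) (C : Finset α) :
    ∀ (p : α) (k : ℕ), ¬ dnI C (k+1) p → k ≤ rk p → ∃ q, q ≤ p ∧ BB rk C (k+1) q := by
  intro p
  induction p using WellFoundedLT.induction with
  | _ p ih =>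
    intro k hp hk
    rcases hk.lt_or_eq with hlt | heq
    · by_cases hmin : ∀ q, q < p → dnI C (k+1) q
      · refine ⟨p, le_rfl, ?_⟩
        unfold BB
        rw [if_neg (by omega)]
        exact (mem_row_iff C (k+1) p).2 ⟨hp, hmin⟩
      · push Not at hmin
        obtain ⟨q, hq, hqn⟩ := hmin
        obtain ⟨x, h1, h2, h3⟩ := exists_lower hrk hq
        obtain ⟨y, hy, hB⟩ := ih x h2 k (fun h => hqn (dnI_mono h h1)) (by omega)
        exact ⟨y, hy.trans h2.le, hB⟩
    · by_cases hd : dnI C k p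
      · refine ⟨p, le_rfl, ?_⟩
        unfold BB
        rw [if_pos (by omega), ← heq]
        exact ⟨hd, hp⟩
      · have hmin : ¬ ∀ q, q < p → dnI C k q := fun h =>
          hp ⟨p, (mem_row_iff C k p).2 ⟨hd, h⟩, le_rfl⟩
        push Not at hmin
        obtain ⟨q, hq, hqn⟩ := hmin
        obtain ⟨x, h1, h2, h3⟩ := exists_lower hrk hq
        obtain ⟨k', rfl⟩ : ∃ k', k = k' + 1 := ⟨k - 1, by omega⟩
        obtain ⟨y, hy, hB⟩ := ih x h2 k' (fun h => hqn (dnI_mono h h1)) (by omega)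
        refine ⟨y, hy.trans h2.le, ?_⟩
        have hyr : rk y ≤ rk x := by
          rcases hy.eq_or_lt with h | h
          · rw [h]
          · exact (rk_strict hrk h).le
        unfold BB at hB ⊢
        rw [if_pos (by omega)] at hB ⊢
        exact hB

theorem BB_anti {rk : α → ℕ} (hrk : IsRankFunction rk) (C : Finset α) {k : ℕ} {p q : α}
    (hp : BB rk C (k+1) p) (hq : BB rk C (k+1) q) (h : q < p) : False := by
  have hr := rk_strict hrk h
  obtain ⟨x, h1, h2, h3⟩ := exists_lower hrk h
  unfold BB at hp hq
  by_cases hpk : rk p < k + 1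
  · rw [if_pos hpk] at hp
    rw [if_pos (by omega)] at hq
    apply hq.2
    refine dnI_descend hrk C (rk q + 1) q (rk x - rk q) x ?_ h1 (by omega)
    have e : rk q + 1 + (rk x - rk q) = rk p := by
      omega
    rw [e]
    exact dnI_mono hp.1 h2.le
  · rw [if_neg hpk] at hp
    have hx := ((mem_row_iff C (k+1) p).1 hp).2 x h2
    by_cases hqk : rk q < k + 1
    · rw [if_pos hqk] at hq
      apply hq.2
      refine dnI_descend hrk C (rk q + 1) q (k - rk q) x ?_ h1 (by omega)
      have e : rk q + 1 + (k - rk q) = k + 1 := by omega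
      rw [e]
      exact hx
    · rw [if_neg hqk] at hq
      exact ((mem_row_iff C (k+1) q).1 hq).1 (dnI_mono hx h1)

theorem toggle_anti (p : α) {A : Finset α} (hA : IsAntichain (· ≤ ·) (↑A : Set α)) :
    IsAntichain (· ≤ ·) (↑(toggle p A) : Set α) := by
  unfold toggle
  split_ifs with h1 h2
  · exact hA.subset (by simp)
  · exact h2
  · exact hA

theorem foldr_toggle_anti (l : List α) {A : Finset α} (hA : IsAntichain (· ≤ ·) (↑A : Set α)) :
    IsAntichain (· ≤ ·) (↑(l.foldr toggle A) : Set α) := by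
  induction l with
  | nil => exact hA
  | cons p l ih => exact toggle_anti p ih

theorem foldr_toggle {rk : α → ℕ} (hrk : IsRankFunction rk) (j : ℕ) (S : Finset α) (T : α → Prop)
    (hS : IsAntichain (· ≤ ·) (↑S : Set α))
    (h1 : ∀ p, rk p = j → p ∈ S → ¬ T p)
    (h2 : ∀ p, rk p = j → p ∉ S → T p → ∀ q ∈ S, rk q ≠ j → ¬ q < p ∧ ¬ p < q)
    (h3 : ∀ p, rk p = j → p ∉ S → ¬ T p → ∃ q ∈ S, rk q ≠ j ∧ (q < p ∨ p < q))
    (l : List α) (hn : l.Nodup) (hl : ∀ p ∈ l, rk p = j) (x : α) :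
    x ∈ l.foldr toggle S ↔ if x ∈ l then T x else x ∈ S := by
  induction l generalizing x with
  | nil => simp
  | cons p l ih =>
    have hn' := List.nodup_cons.1 hn
    have ih' := ih hn'.2 (fun q hq => hl q (List.mem_cons_of_mem _ hq))
    have hanti := foldr_toggle_anti l hS
    have hpj := hl p List.mem_cons_self
    have hlj : ∀ q ∈ l, rk q = j := fun q hq => hl q (List.mem_cons_of_mem _ hq)
    rw [List.foldr_cons]
    generalize List.foldr toggle S l = A at ih' hanti
    have hpA : p ∈ A ↔ p ∈ S := by rw [ih', if_neg hn'.1]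
    have key : ∀ B : Finset α, (p ∈ B ↔ T p) → (∀ y, y ≠ p → (y ∈ B ↔ y ∈ A)) →
        (x ∈ B ↔ if x ∈ p :: l then T x else x ∈ S) := by
      intro B hB1 hB2
      by_cases hx : x = p
      · subst hx; simp [hB1]
      · rw [hB2 x hx, ih']; simp [hx]
    suffices hsuf : (p ∈ toggle p A ↔ T p) ∧ ∀ y, y ≠ p → (y ∈ toggle p A ↔ y ∈ A) from
      key _ hsuf.1 hsuf.2
    unfold toggle
    split_ifs with c1 c2
    · constructor
      · have := h1 p hpj (hpA.1 c1)
        simp [this]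
      · intro y hy; simp [hy]
    · constructor
      · have : T p := by
          by_contra hT
          obtain ⟨q, hq, hqj, hlt⟩ := h3 p hpj (fun h => c1 (hpA.2 h)) hT
          have hqA : q ∈ A := by
            rw [ih', if_neg (fun h => hqj (hlj q h))]; exact hq
          have hne : q ≠ p := fun h => hqj (h ▸ hpj)
          have m1 : q ∈ (↑(insert p A) : Set α) := by simp [hqA]
          have m2 : p ∈ (↑(insert p A) : Set α) := by simp
          rcases hlt with h | h
          · exact c2 m1 m2 hne h.le
          · exact c2 m2 m1 hne.symm h.le
        simp [this]
      · intro y hy; simp [hy]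
    · constructor
      · refine ⟨fun h => absurd h c1, fun hT => ?_⟩
        exfalso
        apply c2
        rw [Finset.coe_insert]
        have hh : ∀ q ∈ A, ¬ q < p ∧ ¬ p < q := by
          intro q hq
          by_cases hqj : rk q = j
          · constructor
            · intro h; have := rk_strict hrk h; omega
            · intro h; have := rk_strict hrk h; omega
          · rw [ih', if_neg (fun h => hqj (hlj q h))] at hq
            exact h2 p hpj (fun h => c1 (hpA.2 h)) hT q hq hqj
        refine hanti.insert ?_ ?_
        · intro b hb hne hle
          exact (hh b hb).1 (lt_of_le_of_ne hle (by first | exact hne | exact hne.symm))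
        · intro b hb hne hle
          exact (hh b hb).2 (lt_of_le_of_ne hle (by first | exact hne | exact hne.symm))
      · intro y hy; rfl

theorem rankToggle_step {rk : α → ℕ} (hrk : IsRankFunction rk) (C : Finset α) (k j : ℕ)
    (hkj : k ≤ j) (S : Finset α) (hS : IsAntichain (· ≤ ·) (↑S : Set α))
    (hSm : ∀ p, p ∈ S ↔ if rk p < j then BB rk C (k+1) p else BB rk C k p) (x : α) :
    x ∈ rankToggle rk j S ↔ if rk x < j + 1 then BB rk C (k+1) x else BB rk C k x := by
  have hBk : ∀ p, j ≤ rk p → (BB rk C k p ↔ p ∈ rowmotion^[k+1] C) := by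
    intro p hp
    unfold BB
    rw [if_neg (by omega)]
  have hBn : ∀ p, k ≤ rk p → BB rk C (k+1) p → ¬ dnI C (k+1) p := by
    intro p hp hB
    unfold BB at hB
    split_ifs at hB with h
    · have : rk p = k := by omega
      rw [this] at hB; exact hB.2
    · exact ((mem_row_iff C (k+1) p).1 hB).1
  unfold rankToggle
  rw [foldr_toggle hrk j S (BB rk C (k+1)) hS ?_ ?_ ?_ _ (Finset.nodup_toList _) (by simp)]
  · simp only [Finset.mem_toList, Finset.mem_filter, Finset.mem_univ, true_and, hSm]
    split_ifs <;> first | rfl | omega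
  · intro p hp hpS hB
    rw [hSm, if_neg (by omega), hBk p hp.ge] at hpS
    exact hBn p (by omega) hB ⟨p, hpS, le_rfl⟩
  · intro p hp hpS hB q hq hqj
    rw [hSm] at hq
    constructor
    · intro h
      have := rk_strict hrk h
      rw [if_pos (by omega)] at hq
      exact BB_anti hrk C hB hq h
    · intro h
      have := rk_strict hrk h
      rw [if_neg (by omega), hBk q (by omega)] at hq
      exact hBn p (by omega) hB ⟨q, hq, h.le⟩
  · intro p hp hpS hB
    rw [hSm, if_neg (by omega), hBk p hp.ge] at hpS
    by_cases hd : dnI C (k+1) p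
    · obtain ⟨a, ha, hpa⟩ := hd
      have hlt : p < a := lt_of_le_of_ne hpa (fun h => hpS (h ▸ ha))
      have := rk_strict hrk hlt
      refine ⟨a, ?_, by omega, Or.inr hlt⟩
      rw [hSm, if_neg (by omega), hBk a (by omega)]
      exact ha
    · obtain ⟨q, hq, hqB⟩ := BB_exists hrk C p k hd (by omega)
      have hlt : q < p := lt_of_le_of_ne hq (fun h => hB (h ▸ hqB))
      have := rk_strict hrk hlt
      refine ⟨q, ?_, by omega, Or.inl hlt⟩
      rw [hSm, if_pos (by omega)]
      exact hqB

theorem pass_aux {rk : α → ℕ} (hrk : IsRankFunction rk) (C : Finset α) (k : ℕ) :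
    ∀ (n : ℕ) (S : Finset α), IsAntichain (· ≤ ·) (↑S : Set α) → (∀ p, p ∈ S ↔ BB rk C k p) →
      IsAntichain (· ≤ ·)
        (↑((List.range' k n).foldl (fun C j => rankToggle rk j C) S) : Set α) ∧
      ∀ x, x ∈ (List.range' k n).foldl (fun C j => rankToggle rk j C) S ↔
        if rk x < k + n then BB rk C (k+1) x else BB rk C k x := by
  intro n S hS hSm
  induction n with
  | zero =>
    refine ⟨hS, fun x => ?_⟩
    simp only [List.range'_zero, List.foldl_nil, hSm, Nat.add_zero]
    split_ifs with h
    · unfold BB; rw [if_pos h, if_pos (by omega)]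
    · rfl
  | succ n ih =>
    rw [List.range'_1_concat, List.foldl_append]
    simp only [List.foldl_cons, List.foldl_nil]
    refine ⟨foldr_toggle_anti _ ih.1, fun x => ?_⟩
    exact rankToggle_step hrk C k (k+n) (by omega) _ ih.1 ih.2 x

theorem rvac_aux {rk : α → ℕ} (hrk : IsRankFunction rk) (C : Finset α) (N : ℕ)
    (hN : ∀ x, rk x ≤ N) (hA : IsAntichain (· ≤ ·) (↑(rowmotion C) : Set α)) (k : ℕ)
    (hk : k ≤ N + 1) :
      IsAntichain (· ≤ ·) (↑((List.range k).foldl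
    (fun B k => (List.range' k (N + 1 - k)).foldl (fun C j => rankToggle rk j C) B)
      (rowmotion C)) : Set α) ∧
      ∀ x, x ∈ (List.range k).foldl
    (fun B k => (List.range' k (N + 1 - k)).foldl (fun C j => rankToggle rk j C) B)
      (rowmotion C) ↔ BB rk C k x := by
  induction k with
  | zero => exact ⟨hA, fun x => by simp [BB]⟩
  | succ k ih =>
    have ih' := ih (by omega)
    rw [List.range_succ, List.foldl_append]
    simp only [List.foldl_cons, List.foldl_nil]
    have := pass_aux hrk C k (N + 1 - k) _ ih'.1 ih'.2
    refine ⟨this.1, fun x => ?_⟩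
    rw [this.2 x, if_pos (by have := hN x; omega)]

theorem mem_rvac {rk : α → ℕ} (hrk : IsRankFunction rk) (C : Finset α)
    (hA : IsAntichain (· ≤ ·) (↑(rowmotion C) : Set α)) (x : α) :
    x ∈ rvac rk (Finset.univ.sup rk) (rowmotion C) ↔
      dnI C (rk x) x ∧ ¬ dnI C (rk x + 1) x := by
  have hN : ∀ x, rk x ≤ Finset.univ.sup rk := fun x => Finset.le_sup (Finset.mem_univ x)
  unfold rvac
  rw [(rvac_aux hrk C _ hN hA _ le_rfl).2 x]
  unfold BB
  rw [if_pos (by have := hN x; omega)]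

theorem row_anti (C : Finset α) : IsAntichain (· ≤ ·) (↑(rowmotion C) : Set α) := by
  intro a ha b hb hne hle
  have ha' := (mem_row_iff C 0 a).1 ha
  have hb' := (mem_row_iff C 0 b).1 hb
  exact ha'.1 (hb'.2 a (lt_of_le_of_ne hle hne))

theorem dnI_shift (C : Finset α) (n k : ℕ) (p : α) :
    dnI (rowmotion^[n] C) k p ↔ dnI C (k + n) p := by
  unfold dnI
  rw [Function.iterate_add_apply]

theorem sum_shift (g : ℕ → ℕ) (m : ℕ) (hg : ∀ n, g (n + m) = g n) (r : ℕ) :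
    ∑ n ∈ Finset.range m, g (n + r) = ∑ n ∈ Finset.range m, g n := by
  induction r with
  | zero => rfl
  | succ r ih =>
    rw [← ih]
    have e1 := Finset.sum_range_succ (fun n => g (n + r)) m
    have e2 := Finset.sum_range_succ' (fun n => g (n + r)) m
    have e3 : g (m + r) = g (0 + r) := by rw [Nat.add_comm m r, hg, Nat.zero_add]
    have e4 : ∀ n, g (n + 1 + r) = g (n + (r + 1)) := fun n => by congr 1; omega
    simp only [e4] at e2
    omega

theorem sum_updown (f : ℕ → Prop) (m : ℕ) (hf : ∀ n, f (n + m) ↔ f n) (r : ℕ) :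
    ∑ n ∈ Finset.range m, (if f (r + n) ∧ ¬ f (r + 1 + n) then 1 else 0) =
      ∑ n ∈ Finset.range m, (if f (n + 1) ∧ ¬ f n then 1 else 0) := by
  have hf1 : ∀ n, f (n + m + 1) ↔ f (n + 1) := fun n => by
    rw [show n + m + 1 = n + 1 + m by omega, hf]
  have s1 := sum_shift (fun n => if f n ∧ ¬ f (n + 1) then 1 else 0) m
    (fun n => by simp only [hf, hf1]) r
  have s2 := sum_shift (fun n => if f n then 1 else 0) m (fun n => by simp only [hf]) 1
  have e : ∀ n, (if f (r + n) ∧ ¬ f (r + 1 + n) then 1 else 0) =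
      (if f (n + r) ∧ ¬ f (n + r + 1) then 1 else 0) := fun n => by
    rw [show r + n = n + r by omega, show r + 1 + n = n + r + 1 by omega]
  simp only [e]
  rw [s1]
  have t : ∑ n ∈ Finset.range m, ((if f n ∧ ¬ f (n + 1) then 1 else 0) + (if f (n+1) then 1 else 0))
      = ∑ n ∈ Finset.range m, ((if f (n + 1) ∧ ¬ f n then 1 else 0) + (if f n then 1 else 0)) := by
    apply Finset.sum_congr rfl
    intro n _
    by_cases a : f n <;> by_cases b : f (n + 1) <;> simp [a, b]
  rw [Finset.sum_add_distrib, Finset.sum_add_distrib] at t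
  omega

theorem sum_rvac_eq {rk : α → ℕ} (hrk : IsRankFunction rk) (C : Finset α) (m : ℕ)
    (hper : rowmotion^[m] C = C) :
    ∑ n ∈ Finset.range m, (rvac rk (Finset.univ.sup rk) (rowmotion^[n+1] C)).card =
      ∑ n ∈ Finset.range m, (rowmotion^[n+1] C).card := by
  have hc : ∀ B : Finset α, B.card = ∑ p : α, if p ∈ B then 1 else 0 := fun B => by simp
  simp only [hc]
  rw [Finset.sum_comm, Finset.sum_comm (s := Finset.range m)]
  apply Finset.sum_congr rfl
  intro p _
  have := sum_updown (fun n => dnI C n p) m (fun n => by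
    rw [← dnI_shift, hper]) (rk p)
  simp only [Function.iterate_succ_apply', mem_rvac hrk _ (row_anti _), dnI_shift]
  simp only [← Function.iterate_succ_apply' rowmotion, mem_row_iff']
  convert this using 2

end Helpers

/-- If `#A + #Rvac(A) = c` for every antichain, then the average cardinality
along every rowmotion orbit is `c/2`, i.e. `2 * Σ_{A ∈ O} #A = c * #O`. -/
theorem rvac_const_sum_implies_homomesy [Fintype α] [PartialOrder α]
    (rk : α → ℕ) (hrk : IsRankFunction rk) (c : ℕ)
    (hc : ∀ A : Finset α, IsAntichain (· ≤ ·) (↑A : Set α) →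
      A.card + (rvac rk (Finset.univ.sup rk) A).card = c)
    (A₀ : Finset α) (hA₀ : IsAntichain (· ≤ ·) (↑A₀ : Set α))
    (m : ℕ) (hm : 0 < m) (hper : rowmotion^[m] A₀ = A₀)
    (hmin : ∀ j : ℕ, 0 < j → j < m → rowmotion^[j] A₀ ≠ A₀)
    (O : Finset (Finset α))
    (hO : O = (Finset.range m).image (fun i => rowmotion^[i] A₀)) :
    2 * ∑ B ∈ O, B.card = c * O.card := by
  have hinj : Set.InjOn (fun i => rowmotion^[i] A₀) (↑(Finset.range m) : Set ℕ) := by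
    have aux : ∀ i j, i < j → j < m → rowmotion^[i] A₀ ≠ rowmotion^[j] A₀ := by
      intro i j hij hj h
      apply hmin (m - j + i) (by omega) (by omega)
      rw [Function.iterate_add_apply, h, ← Function.iterate_add_apply,
        show m - j + j = m by omega, hper]
    intro i hi j hj h
    simp only [Finset.coe_range, Set.mem_Iio] at hi hj
    rcases lt_trichotomy i j with hl | hl | hl
    · exact absurd h (aux i j hl hj)
    · exact hl
    · exact absurd h.symm (aux j i hl hi)
  have hcard : O.card = m := by
    rw [hO, Finset.card_image_of_injOn hinj, Finset.card_range]
  have hsum : ∑ B ∈ O, B.card = ∑ n ∈ Finset.range m, (rowmotion^[n] A₀).card := by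
    rw [hO, Finset.sum_image hinj]
  have hrow : ∀ n, rowmotion^[n+1] (rowmotion^[m-1] A₀) = rowmotion^[n] A₀ := by
    intro n
    rw [← Function.iterate_add_apply, show n + 1 + (m - 1) = n + m by omega,
      Function.iterate_add_apply, hper]
  have hC : rowmotion^[m] (rowmotion^[m-1] A₀) = rowmotion^[m-1] A₀ := by
    rw [← Function.iterate_add_apply, Nat.add_comm, Function.iterate_add_apply, hper]
  have key := sum_rvac_eq hrk (rowmotion^[m-1] A₀) m hC
  simp only [hrow] at key
  have htot : ∑ n ∈ Finset.range m, ((rowmotion^[n] A₀).card +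
      (rvac rk (Finset.univ.sup rk) (rowmotion^[n] A₀)).card) = ∑ n ∈ Finset.range m, c := by
    apply Finset.sum_congr rfl
    intro n _
    apply hc
    cases n with
    | zero => exact hA₀
    | succ n => rw [Function.iterate_succ_apply']; exact row_anti _
  rw [Finset.sum_add_distrib, key, Finset.sum_const, Finset.card_range, smul_eq_mul] at htot
  rw [hsum, hcard, two_mul, htot, Nat.mul_comm]
end
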